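/- arXiv:1608.00015 — 2 statements merged into one kernel-verified Lean document; each statement's English description precedes it below -/
import Mathlib

section
/- (Shift case of the integrability reduction.) Let C_0 be an algebraically closed field of characteristic zero, let C be a field extension of C_0, and let δ : C → C be a derivation whose field of constants {c ∈ C : δ(c) = 0} equals C_0. Extend δ to the rational function field k = C(x) by δ(x) = 1, and let σ be the C-algebra automorphism of k with σ(x) = x + 1 (so that σ∘δ = δ∘σ on k); apply σ and δ to matrices entrywise. Let A ∈ GL_n(C_0(x)), viewed inside GL_n(k). If there exists B ∈ M_n(k) such that σ(B) = A B A^{-1} + δ(A) A^{-1}, then there exists T ∈ GL_n(k) such that σ(T)·A·T^{-1} ∈ GL_n(C_0), i.e., the system σ(Y) = AY is gauge-equivalent over k to a system with constant coefficient matrix. -/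
namespace ShiftIntegrable

open Polynomial

section WeylModule

variable {K M : Type*} [Field K] [AddCommGroup M] [Module K M]

/-- A vector is torsion for an endomorphism `D` if a nonzero polynomial in `D` kills it. -/
def IsTorsionFor (D : Module.End K M) (v : M) : Prop :=
  ∃ g : K[X], g ≠ 0 ∧ aeval D g v = 0

lemma IsTorsionFor.zero (D : Module.End K M) : IsTorsionFor D (0 : M) :=
  ⟨1, one_ne_zero, map_zero _⟩

lemma IsTorsionFor.add {D : Module.End K M} {v w : M} (hv : IsTorsionFor D v)
    (hw : IsTorsionFor D w) : IsTorsionFor D (v + w) := by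
  obtain ⟨g, hg, hgv⟩ := hv
  obtain ⟨h, hh, hhw⟩ := hw
  refine ⟨g * h, mul_ne_zero hg hh, ?_⟩
  rw [map_add, mul_comm g, map_mul, Module.End.mul_apply, hgv, map_zero, zero_add, ← map_mul,
    mul_comm h, map_mul, Module.End.mul_apply, hhw, map_zero]

lemma IsTorsionFor.aeval {D : Module.End K M} {v : M} (hv : IsTorsionFor D v) (p : K[X]) :
    IsTorsionFor D (aeval D p v) := by
  obtain ⟨g, hg, hgv⟩ := hv
  refine ⟨g, hg, ?_⟩
  rw [← Module.End.mul_apply, ← map_mul, mul_comm, map_mul, Module.End.mul_apply, hgv, map_zero]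

lemma IsTorsionFor.of_aeval {D : Module.End K M} {v : M} {p : K[X]} (hp : p ≠ 0)
    (hv : IsTorsionFor D (Polynomial.aeval D p v)) : IsTorsionFor D v := by
  obtain ⟨g, hg, hgv⟩ := hv
  exact ⟨g * p, mul_ne_zero hg hp, by rwa [map_mul, Module.End.mul_apply]⟩

lemma IsTorsionFor.sub {D : Module.End K M} {v w : M} (hv : IsTorsionFor D v)
    (hw : IsTorsionFor D w) : IsTorsionFor D (v - w) := by
  have := hw.aeval (-1)
  rw [map_neg, map_one, LinearMap.neg_apply, Module.End.one_apply] at this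
  rw [sub_eq_add_neg]
  exact hv.add this

/-- The action of a polynomial in `D` and a commuting operator `φ`. -/
noncomputable def biAction (D φ : Module.End K M) (h : Commute D φ) :
    K[X][X] →+* Module.End K M :=
  eval₂RingHom' (aeval D : K[X] →ₐ[K] Module.End K M).toRingHom φ
    fun a => by
      induction a using Polynomial.induction_on' with
      | add p q hp hq => simpa using hp.add_left hq
      | monomial n a =>
        simpa [aeval_monomial] using
          (Algebra.commute_algebraMap_left a φ).mul_left (h.pow_left n)

lemma biAction_C {D φ : Module.End K M} (h : Commute D φ) (p : K[X]) :
    biAction D φ h (C p) = aeval D p :=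
  eval₂_C _ _

lemma biAction_X {D φ : Module.End K M} (h : Commute D φ) : biAction D φ h X = φ :=
  eval₂_X _ _

lemma IsTorsionFor.of_injective {D φ : Module.End K M} (h : Commute D φ)
    (hinj : Function.Injective φ) {v : M}
    (hv : IsTorsionFor D (φ v)) : IsTorsionFor D v := by
  obtain ⟨g, hg, hgv⟩ := hv
  refine ⟨g, hg, hinj ?_⟩
  have hc : biAction D φ h (C g * X) = biAction D φ h (X * C g) := by rw [mul_comm]
  rw [map_mul, map_mul, biAction_C, biAction_X] at hc
  rw [map_zero, ← hgv]
  exact (LinearMap.congr_fun hc v).symm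

/-- If a `φ`-stable subspace has finite rank over the polynomials in `D`, then a nonzero
polynomial in `D` and `φ` sends it to torsion vectors. -/
lemma exists_biAction_isTorsionFor {D φ : Module.End K M} (h : Commute D φ) (L : Set M)
    (hφL : ∀ v ∈ L, φ v ∈ L)
    (hrank : ∃ m : ℕ, ∀ e : Fin m → M, (∀ i, e i ∈ L) →
      ∃ g : Fin m → K[X], g ≠ 0 ∧ ∑ i, aeval D (g i) (e i) = 0) :
    ∃ P : K[X][X], P ≠ 0 ∧ ∀ v ∈ L, IsTorsionFor D (biAction D φ h P v) := by
  classical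
  have hmin := Nat.find_spec hrank
  set m := Nat.find hrank with hm
  obtain _ | r := m
  · obtain ⟨g, hg, -⟩ := hmin (fun i => i.elim0) (fun i => i.elim0)
    exact absurd (Subsingleton.elim g 0) hg
  have hr := Nat.find_min hrank (m := r) (by omega)
  push Not at hr
  obtain ⟨e, heL, he⟩ := hr
  have hpow : ∀ v ∈ L, ∀ i : ℕ, (φ ^ i) v ∈ L := by
    intro v hv i
    induction i with
    | zero => simpa using hv
    | succ i ih => rw [pow_succ', Module.End.mul_apply]; exact hφL _ ih
  have hann : ∀ v ∈ L, ∃ P : K[X][X], P ≠ 0 ∧ biAction D φ h P v = 0 := by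
    intro v hv
    obtain ⟨g, hg, hgv⟩ := hmin (fun i => (φ ^ (i : ℕ)) v) (fun i => hpow v hv i)
    refine ⟨∑ i, C (g i) * X ^ (i : ℕ), fun h0 => hg ?_, ?_⟩
    · funext j
      have := congrArg (fun P => coeff P (j : ℕ)) h0
      simpa [finsetSum_coeff, coeff_C_mul, coeff_X_pow, Fin.val_inj] using this
    · rw [map_sum, LinearMap.sum_apply, ← hgv]
      exact Finset.sum_congr rfl fun i _ => by
        rw [map_mul, map_pow, biAction_C, biAction_X, Module.End.mul_apply]
  choose! Q hQ0 hQ using hann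
  refine ⟨∏ i, Q (e i), Finset.prod_ne_zero_iff.mpr fun i _ => hQ0 _ (heL i), fun v hv => ?_⟩
  set P := ∏ i, Q (e i) with hP
  have hPe : ∀ i, biAction D φ h P (e i) = 0 := fun i => by
    rw [hP, ← Finset.prod_erase_mul _ _ (Finset.mem_univ i), map_mul, Module.End.mul_apply,
      hQ _ (heL i), map_zero]
  have hcomm : ∀ (p : K[X]) (w : M),
      biAction D φ h P (aeval D p w) = aeval D p (biAction D φ h P w) := fun p w => by
    rw [← biAction_C h, ← Module.End.mul_apply, ← map_mul, mul_comm, map_mul,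
      Module.End.mul_apply]
  obtain ⟨g, hg, hgv⟩ := hmin (Fin.cons v e) (Fin.cases hv heL)
  rw [Fin.sum_univ_succ] at hgv
  simp only [Fin.cons_zero, Fin.cons_succ] at hgv
  refine ⟨g 0, fun h0 => hg ?_, ?_⟩
  · rw [h0, map_zero, LinearMap.zero_apply, zero_add] at hgv
    funext j
    refine Fin.cases h0 (fun i => ?_) j
    by_contra hi
    exact he (fun i => g i.succ) (fun h1 => hi (congrFun h1 i)) hgv
  · have := congrArg (biAction D φ h P) hgv
    rwa [map_add, map_sum, map_zero, hcomm, Finset.sum_eq_zero (fun i _ => ?_), add_zero] at this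
    rw [hcomm, hPe, map_zero]

variable [Module K[X] M]

/-- `D` is a connection: it obeys the Leibniz rule with respect to `d/dX`. -/
def IsConnection (D : Module.End K M) : Prop :=
  ∀ (p : K[X]) (v : M), D (p • v) = derivative p • v + p • D v

variable {D : Module.End K M}

/-- Two lattices stable under a connection which are comparable up to a polynomial factor are
comparable. -/
lemma IsConnection.mem_of_smul_mem [CharZero K] (hD : IsConnection D) (L : Submodule K[X] M)
    (hL : ∀ v ∈ L, D v ∈ L) (N : Set M) (hN : ∀ v ∈ N, D v ∈ N) (e : K[X]) (he : e ≠ 0)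
    (h : ∀ v ∈ N, e • v ∈ L) : ∀ v ∈ N, v ∈ L := by
  induction hm : e.natDegree using Nat.strong_induction_on generalizing e with
  | _ m ih =>
    by_cases h0 : e.natDegree = 0
    · obtain ⟨c, rfl⟩ := natDegree_eq_zero.mp h0
      have hc : c ≠ 0 := fun hc => he (by rw [hc, C_0])
      intro v hv
      have := L.smul_mem (C c⁻¹) (h v hv)
      rwa [smul_smul, ← C_mul, inv_mul_cancel₀ hc, C_1, one_smul] at this
    · refine ih _ (hm ▸ natDegree_derivative_lt h0) (derivative e) (derivative_ne_zero.mpr h0)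
        (fun v hv => ?_) rfl
      have h1 := hL _ (h v hv)
      rw [hD] at h1
      exact (L.add_mem_iff_left (h _ (hN v hv))).mp h1

variable [IsScalarTower K K[X] M] {φ : Module.End K M}

lemma IsConnection.aeval_X_smul (hD : IsConnection D) (g : K[X]) (v : M) :
    aeval D g ((X : K[X]) • v) = (X : K[X]) • aeval D g v + aeval D (derivative g) v := by
  have hX : ∀ w : M, D ((X : K[X]) • w) = w + (X : K[X]) • D w := fun w => by
    rw [hD, derivative_X, one_smul]
  have hstep : ∀ (n : ℕ) (w : M), D ((D ^ n) w) = (D ^ (n + 1)) w := fun n w => by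
    rw [pow_succ', Module.End.mul_apply]
  have hpow : ∀ n : ℕ, (D ^ n) ((X : K[X]) • v) =
      (X : K[X]) • (D ^ n) v + (n : K) • (D ^ (n - 1)) v := by
    intro n
    induction n with
    | zero => simp
    | succ n ih =>
      rw [← hstep, ih, map_add, hX, map_smul, hstep, hstep, Nat.add_sub_cancel]
      rcases n with _ | n
      · simp; abel
      · rw [Nat.add_sub_cancel]
        push_cast
        module
  induction g using Polynomial.induction_on' with
  | add p q hp hq =>
    simp only [map_add, LinearMap.add_apply, hp, hq, smul_add]
    abel
  | monomial n a =>
    rw [derivative_monomial, aeval_monomial, aeval_monomial]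
    simp only [Module.End.mul_apply, Module.algebraMap_end_apply, hpow, smul_add, mul_smul,
      smul_comm a (X : K[X])]

lemma IsTorsionFor.X_smul (hD : IsConnection D) {v : M} (hv : IsTorsionFor D v) :
    IsTorsionFor D ((X : K[X]) • v) := by
  obtain ⟨g, hg, hgv⟩ := hv
  refine ⟨g * g, mul_ne_zero hg hg, ?_⟩
  rw [map_mul, Module.End.mul_apply, hD.aeval_X_smul, hgv, smul_zero, zero_add,
    ← Module.End.mul_apply, ← map_mul, mul_comm, map_mul, Module.End.mul_apply, hgv, map_zero]

/-- Commutator of the multiplication by `X` with a polynomial in a connection and a commuting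
shift-semilinear operator. -/
lemma IsConnection.exists_biAction_X_smul (hD : IsConnection D) (h : Commute D φ)
    (hφ : ∀ v : M, φ ((X : K[X]) • v) = (X : K[X]) • φ v + φ v) (P : K[X][X]) :
    ∃ Q : K[X][X], (∀ i, Q.coeff i = derivative (P.coeff i) + (i : K[X]) * P.coeff i) ∧
      ∀ v : M, biAction D φ h P ((X : K[X]) • v) =
        (X : K[X]) • biAction D φ h P v + biAction D φ h Q v := by
  have hpow : ∀ (n : ℕ) (v : M), (φ ^ n) ((X : K[X]) • v) =
      (X : K[X]) • (φ ^ n) v + (n : K) • (φ ^ n) v := by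
    intro n v
    induction n with
    | zero => simp
    | succ n ih =>
      rw [pow_succ', Module.End.mul_apply, ih, map_add, hφ, Module.End.mul_apply, map_smul]
      push_cast
      module
  induction P using Polynomial.induction_on' with
  | add p q hp hq =>
    obtain ⟨p', hp, hp'⟩ := hp
    obtain ⟨q', hq, hq'⟩ := hq
    refine ⟨p' + q', fun i => ?_, fun v => ?_⟩
    · rw [coeff_add, coeff_add, hp, hq, map_add]
      ring
    · simp only [map_add, LinearMap.add_apply, hp', hq', smul_add]
      abel
  | monomial n a =>
    refine ⟨monomial n (derivative a + (n : K[X]) * a), fun i => ?_, fun v => ?_⟩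
    · rw [coeff_monomial, coeff_monomial]
      split_ifs with hi
      · rw [hi]
      · simp
    · simp only [← C_mul_X_pow_eq_monomial, map_mul, map_pow, biAction_X, biAction_C,
        Module.End.mul_apply, hpow, map_add, map_smul, hD.aeval_X_smul, LinearMap.add_apply,
        map_natCast]
      rw [Module.End.natCast_apply, ← Nat.cast_smul_eq_nsmul K]
      abel

/-- If a nonzero polynomial in `D` and `φ` sends `L` to torsion vectors, then `L` is torsion. -/
lemma IsConnection.isTorsionFor_of_biAction [CharZero K] (hD : IsConnection D) (h : Commute D φ)
    (hφ : ∀ v : M, φ ((X : K[X]) • v) = (X : K[X]) • φ v + φ v)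
    (hinj : Function.Injective φ) (L : Submodule K[X] M) (P : K[X][X]) (hP : P ≠ 0)
    (hL : ∀ v ∈ L, IsTorsionFor D (biAction D φ h P v)) : ∀ v ∈ L, IsTorsionFor D v := by
  induction hm : P.natDegree using Nat.strong_induction_on generalizing P with
  | _ m ih =>
    have hdiv : ∀ Q : K[X][X], Q ≠ 0 → Q.natDegree ≤ m → Q.coeff 0 = 0 →
        (∀ v ∈ L, IsTorsionFor D (biAction D φ h Q v)) → ∀ v ∈ L, IsTorsionFor D v := by
      intro Q hQ hQm hQ0 hQL
      obtain ⟨Q', rfl⟩ := X_dvd_iff.mpr hQ0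
      have hQ' : Q' ≠ 0 := right_ne_zero_of_mul hQ
      rw [natDegree_X_mul hQ'] at hQm
      refine ih _ (by omega) Q' hQ' (fun v hv => ?_) rfl
      have := hQL v hv
      rw [map_mul, biAction_X, Module.End.mul_apply] at this
      exact this.of_injective h hinj
    by_cases hP0 : P.coeff 0 = 0
    · exact hdiv P hP hm.le hP0 hL
    rcases Nat.eq_zero_or_pos m with hm0 | hm0
    · rw [eq_C_of_natDegree_eq_zero (hm.trans hm0)] at hL
      intro v hv
      have := hL v hv
      rw [biAction_C] at this
      exact this.of_aeval hP0
    obtain ⟨Q, hQc, hQ⟩ := hD.exists_biAction_X_smul h hφ P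
    set R := C (P.coeff 0) * Q - C (derivative (P.coeff 0)) * P with hR
    have hRc : ∀ i, R.coeff i = P.coeff 0 * (derivative (P.coeff i) + (i : K[X]) * P.coeff i) -
        derivative (P.coeff 0) * P.coeff i := fun i => by
      rw [hR, coeff_sub, coeff_C_mul, coeff_C_mul, hQc]
    have hlc : P.coeff m ≠ 0 := by
      rw [← hm]
      exact leadingCoeff_ne_zero.mpr hP
    refine hdiv R (fun hR0 => ?_) ?_ (by rw [hRc]; push_cast; ring) (fun v hv => ?_)
    · have h1 : (m : K[X]) * (P.coeff 0 * P.coeff m) =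
          derivative (P.coeff 0) * P.coeff m - P.coeff 0 * derivative (P.coeff m) := by
        have := hRc m
        rw [hR0, coeff_zero] at this
        linear_combination -this
      have h2 : derivative (P.coeff 0) * P.coeff m - P.coeff 0 * derivative (P.coeff m) ≠ 0 := by
        rw [← h1]
        exact mul_ne_zero (Nat.cast_ne_zero.mpr hm0.ne') (mul_ne_zero hP0 hlc)
      have h3 : (derivative (P.coeff 0) * P.coeff m - P.coeff 0 * derivative (P.coeff m)).degree <
          (P.coeff 0 * P.coeff m).degree := by
        refine (degree_sub_le _ _).trans_lt (max_lt ?_ ?_)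
        · rw [degree_mul, degree_mul]
          exact WithBot.add_lt_add_right (degree_ne_bot.mpr hlc) (degree_derivative_lt hP0)
        · rw [degree_mul, degree_mul]
          exact WithBot.add_lt_add_left (degree_ne_bot.mpr hP0) (degree_derivative_lt hlc)
      rw [← h1, ← C_eq_natCast, degree_C_mul (Nat.cast_ne_zero.mpr hm0.ne')] at h3
      exact lt_irrefl _ h3
    · rw [natDegree_le_iff_coeff_eq_zero]
      intro i hi
      rw [hRc, coeff_eq_zero_of_natDegree_lt (n := i) (by omega)]
      simp
    · have h1 : IsTorsionFor D (biAction D φ h Q v) := by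
        have h2 := (hL _ (L.smul_mem X hv)).sub ((hL v hv).X_smul hD)
        rwa [hQ, add_sub_cancel_left] at h2
      rw [hR, map_sub, map_mul, map_mul, biAction_C, biAction_C]
      exact (h1.aeval _).sub ((hL v hv).aeval _)

end WeylModule

section Lattice

variable {K M : Type*} [Field K] [AddCommGroup M] [Module K[X] M] {n : ℕ}

lemma lattice_eq_sum (emb : (Fin n → K[X]) →ₗ[K[X]] M) (u : Fin n → K[X]) :
    emb u = ∑ i, u i • emb (Pi.single i 1) := by
  conv_lhs => rw [← Finset.univ_sum_single u]
  rw [map_sum]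
  refine Finset.sum_congr rfl fun i _ => ?_
  rw [← map_smul, ← Pi.single_smul, smul_eq_mul, mul_one]

lemma exists_common_smul_mem (emb : (Fin n → K[X]) →ₗ[K[X]] M)
    (hfull : ∀ v : M, ∃ g : K[X], g ≠ 0 ∧ g • v ∈ LinearMap.range emb) (w : Fin n → M) :
    ∃ g : K[X], g ≠ 0 ∧ ∀ i, g • w i ∈ LinearMap.range emb := by
  classical
  choose g hg0 hg using fun i => hfull (w i)
  refine ⟨∏ i, g i, Finset.prod_ne_zero_iff.mpr fun i _ => hg0 i, fun i => ?_⟩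
  rw [← Finset.prod_erase_mul _ _ (Finset.mem_univ i), mul_smul]
  exact Submodule.smul_mem _ _ (hg i)

lemma smul_lattice_mem (emb : (Fin n → K[X]) →ₗ[K[X]] M) (ψ : M →+ M)
    (c : K) (hψ : ∀ (p : K[X]) (v : M), ψ (p • v) = taylor c p • ψ v) (L : Submodule K[X] M)
    (g : K[X]) (hg : ∀ i, g • ψ (emb (Pi.single i 1)) ∈ L) :
    ∀ v ∈ LinearMap.range emb, g • ψ v ∈ L := by
  rintro _ ⟨u, rfl⟩
  rw [lattice_eq_sum, map_sum, Finset.smul_sum]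
  refine Submodule.sum_mem _ fun i _ => ?_
  rw [hψ, smul_comm]
  exact Submodule.smul_mem _ _ (hg i)

/-- The lattice `range emb` with the powers of `d` inverted. -/
def localizedLattice (emb : (Fin n → K[X]) →ₗ[K[X]] M) (d : K[X]) : Submodule K[X] M where
  carrier := {v | ∃ a : ℕ, d ^ a • v ∈ LinearMap.range emb}
  zero_mem' := ⟨0, by rw [smul_zero]; exact Submodule.zero_mem _⟩
  add_mem' := by
    rintro v w ⟨a, ha⟩ ⟨b, hb⟩
    refine ⟨a + b, ?_⟩
    rw [smul_add]
    refine Submodule.add_mem _ ?_ ?_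
    · rw [pow_add, mul_comm, mul_smul]
      exact Submodule.smul_mem _ _ ha
    · rw [pow_add, mul_smul]
      exact Submodule.smul_mem _ _ hb
  smul_mem' := by
    rintro p v ⟨a, ha⟩
    refine ⟨a, ?_⟩
    rw [smul_comm]
    exact Submodule.smul_mem _ _ ha

variable [Module K M] {D : Module.End K M}

lemma IsConnection.smul_map_lattice (hD : IsConnection D) (emb : (Fin n → K[X]) →ₗ[K[X]] M)
    (d : K[X]) (β : Fin n → Fin n → K[X])
    (hβ : ∀ i, d • D (emb (Pi.single i 1)) = emb (β i)) (u : Fin n → K[X]) :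
    d • D (emb u) = emb (fun j => d * derivative (u j) + ∑ i, u i * β i j) := by
  have h1 : (fun j => d * derivative (u j) + ∑ i, u i * β i j) =
      d • (fun j => derivative (u j)) + ∑ i, u i • β i := by
    funext j
    simp [Finset.sum_apply]
  rw [h1, map_add, map_smul, map_sum, lattice_eq_sum emb u, map_sum, Finset.smul_sum,
    lattice_eq_sum emb (fun j => derivative (u j)), Finset.smul_sum, ← Finset.sum_add_distrib]
  refine Finset.sum_congr rfl fun i _ => ?_
  rw [hD, smul_add, map_smul, ← hβ, smul_comm (u i) d]

/-- Differentiation of a vector with denominator `d ^ j`. -/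
lemma IsConnection.pow_succ_smul_map (hD : IsConnection D) (d : K[X]) (j : ℕ) (v : M) :
    d ^ (j + 1) • D v = d • D (d ^ j • v) - ((j : K[X]) * derivative d) • (d ^ j • v) := by
  rw [hD, derivative_pow]
  rcases j with _ | j
  · simp
  · rw [Nat.add_sub_cancel]
    simp only [C_eq_natCast]
    module

/-- Inverting a denominator of a connection on a lattice gives a connection of finite rank over
the polynomials in `D`. -/
lemma IsConnection.exists_rank_bound [IsScalarTower K K[X] M] [Module.IsTorsionFree K[X] M]
    (hD : IsConnection D) (emb : (Fin n → K[X]) →ₗ[K[X]] M)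
    (d : K[X]) (hd : d ≠ 0) (β : Fin n → Fin n → K[X])
    (hβ : ∀ i, d • D (emb (Pi.single i 1)) = emb (β i)) :
    ∃ m : ℕ, ∀ e : Fin m → M, (∀ i, e i ∈ localizedLattice emb d) →
      ∃ g : Fin m → K[X], g ≠ 0 ∧ ∑ i, aeval D (g i) (e i) = 0 := by
  classical
  set b : ℕ := d.natDegree + ∑ i, ∑ j, (β i j).natDegree with hb
  have hβb : ∀ i j, (β i j).natDegree ≤ b := fun i j =>
    ((Finset.single_le_sum (f := fun j => (β i j).natDegree) (fun _ _ => Nat.zero_le _)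
      (Finset.mem_univ j)).trans (Finset.single_le_sum
        (f := fun i => ∑ j, (β i j).natDegree) (fun _ _ => Nat.zero_le _)
          (Finset.mem_univ i))).trans (Nat.le_add_left _ _)
  refine ⟨n * b + 1, fun e he => ?_⟩
  choose a u hu using he
  set a0 := ∑ i, a i
  have ha0 : ∀ i, a i ≤ a0 := fun i =>
    Finset.single_le_sum (f := a) (fun _ _ => Nat.zero_le _) (Finset.mem_univ i)
  set N0 : ℕ := ∑ i, ∑ j, (d ^ (a0 - a i) * u i j).natDegree with hN0
  have hstart : ∀ i, ∃ w : Fin n → K[X], d ^ a0 • e i = emb w ∧ ∀ j, (w j).natDegree ≤ N0 := by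
    intro i
    refine ⟨d ^ (a0 - a i) • u i, ?_, fun j => ?_⟩
    · rw [map_smul, hu, smul_smul, ← pow_add, Nat.sub_add_cancel (ha0 i)]
    · exact (Finset.single_le_sum (f := fun j => (d ^ (a0 - a i) * u i j).natDegree)
        (fun _ _ => Nat.zero_le _) (Finset.mem_univ j)).trans (Finset.single_le_sum
        (f := fun i => ∑ j, (d ^ (a0 - a i) * u i j).natDegree) (fun _ _ => Nat.zero_le _)
          (Finset.mem_univ i))
  have hstep : ∀ (l : ℕ) (i), ∃ w : Fin n → K[X], d ^ (a0 + l) • (D ^ l) (e i) = emb w ∧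
      ∀ j, (w j).natDegree ≤ N0 + b * l := by
    intro l i
    induction l with
    | zero => simpa using hstart i
    | succ l ih =>
      obtain ⟨w, hw, hwd⟩ := ih
      refine ⟨(fun j => d * derivative (w j) + ∑ i, w i * β i j) -
        (((a0 + l : ℕ) : K[X]) * derivative d) • w, ?_, fun j => ?_⟩
      · rw [← add_assoc, pow_succ' D, Module.End.mul_apply, hD.pow_succ_smul_map, hw,
          hD.smul_map_lattice emb d β hβ, ← map_smul, ← map_sub]
      · have hdb : d.natDegree ≤ b := Nat.le_add_right _ _
        simp only [Pi.sub_apply, Pi.smul_apply, smul_eq_mul]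
        refine (natDegree_sub_le _ _).trans
          (max_le ((natDegree_add_le _ _).trans (max_le ?_ ?_)) ?_)
        · refine natDegree_mul_le.trans ?_
          have := natDegree_derivative_le (w j)
          have := hwd j
          rw [mul_add]
          omega
        · refine natDegree_sum_le_of_forall_le _ _ fun i _ => natDegree_mul_le.trans ?_
          have := hβb i j
          have := hwd i
          rw [mul_add]
          omega
        · refine natDegree_mul_le.trans ?_
          have h1 : ((a0 + l : ℕ) * derivative d : K[X]).natDegree ≤ d.natDegree := by
            refine natDegree_mul_le.trans ?_
            rw [natDegree_natCast, zero_add]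
            exact (natDegree_derivative_le d).trans (Nat.sub_le _ _)
          have := hwd j
          rw [mul_add]
          omega
  set J : ℕ := n * (N0 + 1) with hJ
  set N : ℕ := N0 + b * J + 1 with hN
  have hall : ∀ (i : Fin (n * b + 1)) (l : Fin (J + 1)), ∃ w : Fin n → K[X],
      d ^ (a0 + J) • (D ^ (l : ℕ)) (e i) = emb w ∧ ∀ j, (w j).natDegree < N := by
    intro i l
    obtain ⟨w, hw, hwd⟩ := hstep l i
    have hl : (l : ℕ) ≤ J := Nat.lt_succ_iff.mp l.2
    refine ⟨d ^ (J - l) • w, ?_, fun j => ?_⟩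
    · rw [map_smul, ← hw, smul_smul, ← pow_add]
      congr 2
      omega
    · have h1 : (d ^ (J - l) * w j).natDegree ≤ (J - l) * d.natDegree + (w j).natDegree :=
        natDegree_mul_le.trans (Nat.add_le_add_right natDegree_pow_le _)
      have h2 : (J - l) * d.natDegree ≤ b * (J - l) := by
        rw [mul_comm b]
        exact Nat.mul_le_mul_left _ (Nat.le_add_right _ _)
      have h3 : b * (J - l) + b * l = b * J := by rw [← mul_add, Nat.sub_add_cancel hl]
      have := hwd j
      rw [Pi.smul_apply, smul_eq_mul]
      omega
  choose w hw hwd using hall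
  let f : (Fin (n * b + 1) × Fin (J + 1) → K) →ₗ[K] (Fin n × Fin N → K) :=
    { toFun := fun c q => ∑ p, c p * (w p.1 p.2 q.1).coeff q.2
      map_add' := fun c c' => by
        funext q
        simp [add_mul, Finset.sum_add_distrib]
      map_smul' := fun r c => by
        funext q
        simp [mul_assoc, Finset.mul_sum] }
  have hlt : Module.finrank K (Fin n × Fin N → K) <
      Module.finrank K (Fin (n * b + 1) × Fin (J + 1) → K) := by
    simp only [Module.finrank_fintype_fun_eq_card, Fintype.card_prod, Fintype.card_fin]
    rw [hN, hJ]
    nlinarith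
  obtain ⟨c, hc, hc0⟩ := (Submodule.ne_bot_iff _).mp
    (LinearMap.ker_ne_bot_of_finrank_lt hlt (f := f))
  have hsum : ∑ p : Fin (n * b + 1) × Fin (J + 1), C (c p) • w p.1 p.2 = 0 := by
    funext j
    ext s
    simp only [Finset.sum_apply, Pi.smul_apply, smul_eq_mul, finsetSum_coeff, coeff_C_mul,
      Pi.zero_apply, coeff_zero]
    by_cases hs : s < N
    · exact congrFun (LinearMap.mem_ker.mp hc) (j, ⟨s, hs⟩)
    · refine Finset.sum_eq_zero fun p _ => ?_
      rw [coeff_eq_zero_of_natDegree_lt ((hwd p.1 p.2 j).trans_le (not_lt.mp hs)), mul_zero]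
  refine ⟨fun i => ∑ l : Fin (J + 1), C (c (i, l)) * X ^ (l : ℕ), fun h0 => hc0 ?_, ?_⟩
  · funext ⟨i, l⟩
    have := congrArg (fun P => coeff P (l : ℕ)) (congrFun h0 i)
    simpa [finsetSum_coeff, coeff_C_mul, coeff_X_pow, Fin.val_inj] using this
  · have h1 : d ^ (a0 + J) • ∑ i, aeval D (∑ l : Fin (J + 1), C (c (i, l)) * X ^ (l : ℕ)) (e i) =
        0 := by
      rw [← map_zero emb, ← hsum, map_sum, Fintype.sum_prod_type, Finset.smul_sum]
      refine Finset.sum_congr rfl fun i _ => ?_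
      rw [map_sum, LinearMap.sum_apply, Finset.smul_sum]
      refine Finset.sum_congr rfl fun l _ => ?_
      rw [map_smul, ← hw, map_mul, map_pow, aeval_C, aeval_X, Module.End.mul_apply,
        Module.algebraMap_end_apply, smul_comm (C (c (i, l))), ← algebraMap_eq,
        algebraMap_smul]
    exact (smul_eq_zero.mp h1).resolve_left (pow_ne_zero _ hd)

lemma exists_isCoprime_taylor [IsAlgClosed K] [CharZero K] {d : K[X]} (hd : d ≠ 0) :
    ∃ N : ℕ, IsCoprime d (taylor (-(N : K)) d) := by
  classical
  have hfin : ((fun N : ℕ => (N : K)) ⁻¹'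
      (((d.roots.toFinset ×ˢ d.roots.toFinset).image fun q => q.1 - q.2 : Finset K) :
        Set K)).Finite :=
    (Finset.finite_toSet _).preimage Nat.cast_injective.injOn
  obtain ⟨N, hN⟩ := hfin.exists_notMem
  refine ⟨N, (isCoprime_iff_aeval_ne_zero_of_isAlgClosed K K _ _).mpr fun a => ?_⟩
  by_contra! h0
  simp only [coe_aeval_eq_eval, taylor_eval] at h0
  refine hN ?_
  simp only [Set.mem_preimage, Finset.mem_coe, Finset.mem_image, Finset.mem_product,
    Multiset.mem_toFinset, mem_roots hd, IsRoot.def]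
  exact ⟨(a, a + -N), h0, by ring⟩

lemma IsConnection.map_mem_localizedLattice (hD : IsConnection D)
    (emb : (Fin n → K[X]) →ₗ[K[X]] M) (d : K[X]) (β : Fin n → Fin n → K[X])
    (hβ : ∀ i, d • D (emb (Pi.single i 1)) = emb (β i)) {v : M}
    (hv : v ∈ localizedLattice emb d) : D v ∈ localizedLattice emb d := by
  obtain ⟨a, u, hu⟩ := hv
  refine ⟨a + 1, ?_⟩
  rw [hD.pow_succ_smul_map, ← hu, hD.smul_map_lattice emb d β hβ]
  exact Submodule.sub_mem _ ⟨_, rfl⟩ (Submodule.smul_mem _ _ ⟨_, rfl⟩)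

/-- A connection over `K(X)` commuting with a shift-semilinear bijection has, up to polynomial
factors, only torsion vectors. -/
theorem IsConnection.exists_smul_isTorsionFor [IsAlgClosed K] [CharZero K]
    [IsScalarTower K K[X] M] [Module.IsTorsionFree K[X] M]
    (hD : IsConnection D) (emb : (Fin n → K[X]) →ₗ[K[X]] M)
    (hfull : ∀ v : M, ∃ g : K[X], g ≠ 0 ∧ g • v ∈ LinearMap.range emb)
    (φ : Module.End K M) (hbij : Function.Bijective φ)
    (hφ : ∀ (p : K[X]) (v : M), φ (p • v) = taylor 1 p • φ v) (h : Commute D φ) (v : M) :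
    ∃ g : K[X], g ≠ 0 ∧ IsTorsionFor D (g • v) := by
  obtain ⟨d, hd, hdb⟩ := exists_common_smul_mem emb hfull fun i => D (emb (Pi.single i 1))
  choose β hβ using hdb
  replace hβ := fun i => (hβ i).symm
  obtain ⟨N, hN⟩ := exists_isCoprime_taylor hd
  set ψ := φ ^ N with hψ_def
  have hψ : ∀ (p : K[X]) (v : M), ψ (p • v) = taylor (N : K) p • ψ v := by
    rw [hψ_def]
    clear hN hψ_def ψ
    intro p v
    induction N with
    | zero => simp
    | succ N ih =>
      rw [pow_succ', Module.End.mul_apply, ih, hφ, taylor_taylor, Module.End.mul_apply]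
      push_cast
      rw [add_comm]
  have hψbij : Function.Bijective ψ := by
    rw [hψ_def, Module.End.coe_pow]
    exact hbij.iterate N
  have hDψ : Commute D ψ := h.pow_right N
  let ψe : M ≃+ M := AddEquiv.ofBijective ψ.toAddMonoidHom hψbij
  have hψe : ∀ w, ψ (ψe.symm w) = w := fun w => ψe.apply_symm_apply w
  have hψs : ∀ (p : K[X]) (v : M), ψe.symm (p • v) = taylor (-(N : K)) p • ψe.symm v := by
    intro p v
    refine hψbij.1 ?_
    rw [hψe, hψ, hψe, taylor_taylor, add_neg_cancel, taylor_zero]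
  let L : Submodule K[X] M :=
    { carrier := {v | v ∈ localizedLattice emb d ∧ ψ v ∈ localizedLattice emb d}
      zero_mem' := ⟨Submodule.zero_mem _, by rw [map_zero]; exact Submodule.zero_mem _⟩
      add_mem' := fun hv hw => ⟨Submodule.add_mem _ hv.1 hw.1, by
        rw [map_add]; exact Submodule.add_mem _ hv.2 hw.2⟩
      smul_mem' := fun p v hv => ⟨Submodule.smul_mem _ p hv.1, by
        rw [hψ]; exact Submodule.smul_mem _ _ hv.2⟩ }
  have hDL : ∀ v ∈ L, D v ∈ L := fun v hv =>
    ⟨hD.map_mem_localizedLattice emb d β hβ hv.1, by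
      have : ψ (D v) = D (ψ v) := (LinearMap.congr_fun hDψ v).symm
      rw [this]
      exact hD.map_mem_localizedLattice emb d β hβ hv.2⟩
  -- `L` is contained in a lattice.
  obtain ⟨e, he, heL⟩ : ∃ e : K[X], e ≠ 0 ∧ ∀ v ∈ L, e • v ∈ LinearMap.range emb := by
    obtain ⟨e, he, hel⟩ := exists_common_smul_mem emb hfull
      fun i => ψe.symm (emb (Pi.single i 1))
    refine ⟨e, he, ?_⟩
    rintro v ⟨⟨a, ha⟩, ⟨b, hb⟩⟩
    have h1 : d ^ a • e • v ∈ LinearMap.range emb := by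
      rw [smul_comm]
      exact Submodule.smul_mem _ _ ha
    have h2 : taylor (-(N : K)) d ^ b • e • v ∈ LinearMap.range emb := by
      have := smul_lattice_mem emb ψe.symm.toAddMonoidHom (-(N : K)) hψs _ e hel _ hb
      simp only [AddEquiv.toAddMonoidHom_eq_coe, AddMonoidHom.coe_coe, hψs, taylor_pow] at this
      rw [smul_comm]
      rwa [show ψe.symm (ψ v) = v from ψe.symm_apply_apply v] at this
    obtain ⟨x, y, hxy⟩ := hN.pow (m := a) (n := b)
    rw [← one_smul K[X] (e • v), ← hxy, add_smul, mul_smul, mul_smul]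
    exact Submodule.add_mem _ (Submodule.smul_mem _ _ h1) (Submodule.smul_mem _ _ h2)
  have hLfull : ∀ v : M, ∃ g : K[X], g ≠ 0 ∧ g • v ∈ L := by
    intro v
    obtain ⟨g, hg, hgv⟩ := hfull v
    obtain ⟨g', hg', hgv'⟩ := hfull (ψ v)
    refine ⟨g * taylor (-(N : K)) g', mul_ne_zero hg (by rwa [Ne, taylor_eq_zero]), ?_, ?_⟩
    · refine ⟨0, ?_⟩
      rw [pow_zero, one_smul, mul_comm, mul_smul]
      exact Submodule.smul_mem _ _ hgv
    · refine ⟨0, ?_⟩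
      rw [pow_zero, one_smul, hψ, taylor_mul, taylor_taylor, add_neg_cancel, taylor_zero, mul_smul]
      exact Submodule.smul_mem _ _ hgv'
  have hφL : ∀ v ∈ L, φ v ∈ L := by
    classical
    obtain ⟨g, hg, hgL⟩ : ∃ g : K[X], g ≠ 0 ∧ ∀ v ∈ LinearMap.range emb, g • v ∈ L := by
      choose g hg0 hg using fun i => hLfull (emb (Pi.single i 1))
      refine ⟨∏ i, g i, Finset.prod_ne_zero_iff.mpr fun i _ => hg0 i,
        smul_lattice_mem emb (AddMonoidHom.id M) 0 (fun p v => by rw [taylor_zero]; rfl) L _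
          fun i => ?_⟩
      rw [← Finset.prod_erase_mul _ _ (Finset.mem_univ i), mul_smul]
      exact Submodule.smul_mem _ _ (hg i)
    obtain ⟨g', hg', hgl'⟩ := exists_common_smul_mem emb hfull fun i => φ (emb (Pi.single i 1))
    have key := hD.mem_of_smul_mem L hDL (φ '' L) (by
      rintro _ ⟨v, hv, rfl⟩
      exact ⟨D v, hDL v hv, (LinearMap.congr_fun h v).symm⟩) (g * g' * taylor 1 e)
      (mul_ne_zero (mul_ne_zero hg hg') (by rwa [Ne, taylor_eq_zero])) (by
        rintro _ ⟨v, hv, rfl⟩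
        rw [mul_smul, mul_smul, ← hφ]
        exact hgL _ (smul_lattice_mem emb φ.toAddMonoidHom 1 hφ _ g' hgl' _ (heL v hv)))
    exact fun v hv => key _ ⟨v, hv, rfl⟩
  obtain ⟨m, hm⟩ := hD.exists_rank_bound emb d hd β hβ
  obtain ⟨P, hP, hPL⟩ := exists_biAction_isTorsionFor h L hφL
    ⟨m, fun e he => hm e fun i => (he i).1⟩
  obtain ⟨g, hg, hgv⟩ := hLfull v
  refine ⟨g, hg, hD.isTorsionFor_of_biAction h (fun w => ?_) hbij.1 L P hP hPL _ hgv⟩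
  rw [hφ, taylor_X, add_smul, C_1, one_smul]

end Lattice

section Eigenvectors

variable {K M : Type*} [Field K] [CharZero K]

lemma exists_derivative_add_C_mul (c : K) (p : K[X]) : ∃ q : K[X], derivative q + C c * q = p := by
  induction p using Polynomial.induction_on' with
  | add p q hp hq =>
    obtain ⟨p', rfl⟩ := hp
    obtain ⟨q', rfl⟩ := hq
    exact ⟨p' + q', by rw [map_add]; ring⟩
  | monomial m a =>
    suffices h : ∃ q : K[X], derivative q + C c * q = X ^ m by
      obtain ⟨q, hq⟩ := h
      refine ⟨C a * q, ?_⟩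
      rw [derivative_C_mul, ← C_mul_X_pow_eq_monomial, ← hq]
      ring
    rcases eq_or_ne c 0 with rfl | hc
    · refine ⟨C ((m + 1 : K)⁻¹) * X ^ (m + 1), ?_⟩
      have hm : (m + 1 : K) ≠ 0 := Nat.cast_add_one_ne_zero m
      rw [derivative_C_mul, derivative_X_pow, C_0, zero_mul, add_zero, Nat.add_sub_cancel,
        ← mul_assoc, Nat.cast_succ, ← C_mul, inv_mul_cancel₀ hm, C_1, one_mul]
    · have hcc : C c * C c⁻¹ = (1 : K[X]) := by rw [← C_mul, mul_inv_cancel₀ hc, C_1]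
      induction m with
      | zero => exact ⟨C c⁻¹, by rw [derivative_C, zero_add, hcc, pow_zero]⟩
      | succ m ih =>
        obtain ⟨q, hq⟩ := ih
        refine ⟨C c⁻¹ * (X ^ (m + 1) - C (m + 1 : K) * q), ?_⟩
        rw [derivative_C_mul, derivative_sub, derivative_C_mul, derivative_X_pow,
          Nat.add_sub_cancel, Nat.cast_succ]
        linear_combination X ^ (m + 1) * hcc - C c⁻¹ * C (m + 1 : K) * hq

variable [AddCommGroup M] [Module K M] [Module K[X] M] [IsScalarTower K K[X] M]
  {D : Module.End K M}

lemma IsConnection.exists_sub_smul_eq (hD : IsConnection D) (c : K) {w : M}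
    (hw : w ∈ Submodule.span K[X] {u : M | ∃ μ : K, D u = μ • u}) :
    ∃ v ∈ Submodule.span K[X] {u : M | ∃ μ : K, D u = μ • u}, D v - c • v = w := by
  suffices h : ∀ p : K[X],
      ∃ v ∈ Submodule.span K[X] {u : M | ∃ μ : K, D u = μ • u}, D v - c • v = p • w by
    simpa using h 1
  induction hw using Submodule.span_induction with
  | mem u hu =>
    intro p
    obtain ⟨μ, hμ⟩ := id hu
    obtain ⟨q, hq⟩ := exists_derivative_add_C_mul (μ - c) p
    refine ⟨q • u, Submodule.smul_mem _ _ (Submodule.subset_span hu), ?_⟩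
    rw [hD, hμ, ← hq, add_smul, mul_comm, mul_smul, ← algebraMap_eq, algebraMap_smul, sub_smul,
      smul_sub, smul_comm c q]
    abel
  | zero => exact fun p => ⟨0, Submodule.zero_mem _, by simp⟩
  | add x y _ _ hx hy =>
    intro p
    obtain ⟨v, hv, hvx⟩ := hx p
    obtain ⟨v', hv', hvy⟩ := hy p
    refine ⟨v + v', Submodule.add_mem _ hv hv', ?_⟩
    rw [smul_add p, ← hvx, ← hvy, map_add, smul_add]
    abel
  | smul q x _ hx =>
    intro p
    rw [smul_smul]
    exact hx _

/-- Torsion vectors of a connection are polynomial combinations of its eigenvectors. -/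
lemma IsConnection.mem_span_eigenvectors [IsAlgClosed K] (hD : IsConnection D) {v : M}
    (hv : IsTorsionFor D v) : v ∈ Submodule.span K[X] {u : M | ∃ μ : K, D u = μ • u} := by
  obtain ⟨g, hg, hgv⟩ := hv
  induction hm : g.natDegree using Nat.strong_induction_on generalizing g v with
  | _ m ih =>
    by_cases h0 : g.natDegree = 0
    · obtain ⟨c, rfl⟩ := natDegree_eq_zero.mp h0
      rw [aeval_C, Module.algebraMap_end_apply] at hgv
      have hc : c ≠ 0 := fun hc => hg (by rw [hc, C_0])
      rw [(smul_eq_zero.mp hgv).resolve_left hc]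
      exact Submodule.zero_mem _
    · obtain ⟨c, hc⟩ := IsAlgClosed.exists_root g
        fun hdeg => h0 (natDegree_eq_zero_iff_degree_le_zero.mpr hdeg.le)
      obtain ⟨q, rfl⟩ := dvd_iff_isRoot.mpr hc
      have hq : q ≠ 0 := right_ne_zero_of_mul hg
      rw [mul_comm, map_mul, Module.End.mul_apply, map_sub, aeval_X, aeval_C,
        LinearMap.sub_apply, Module.algebraMap_end_apply] at hgv
      rw [natDegree_mul (X_sub_C_ne_zero c) hq, natDegree_X_sub_C] at hm
      obtain ⟨v', hv', hvv'⟩ := hD.exists_sub_smul_eq c (ih _ (by omega) q hq hgv rfl)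
      rw [← sub_add_cancel v v']
      refine Submodule.add_mem _ (Submodule.subset_span ⟨c, ?_⟩) hv'
      rw [map_sub, smul_sub, sub_eq_sub_iff_sub_eq_sub, hvv']

end Eigenvectors

section RatFunc

variable {K : Type*} [Field K] [CharZero K]

lemma exists_algebraMap_eq_of_derivation_eq_mul (d : Derivation K (RatFunc K) (RatFunc K))
    (hd : ∀ p : K[X], d (algebraMap K[X] (RatFunc K) p) =
      algebraMap K[X] (RatFunc K) (derivative p)) (c : K) (f : RatFunc K)
    (hf : d f = algebraMap K (RatFunc K) c * f) : ∃ a : K, algebraMap K (RatFunc K) a = f := by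
  have hqf : algebraMap K[X] (RatFunc K) f.denom * f = algebraMap K[X] (RatFunc K) f.num := by
    have h0 : algebraMap K[X] (RatFunc K) f.denom ≠ 0 := by simpa using f.denom_ne_zero
    rw [mul_comm]
    exact ((div_eq_iff h0).mp f.num_div_denom).symm
  have hc : algebraMap K (RatFunc K) c = algebraMap K[X] (RatFunc K) (C c) := by
    rw [← algebraMap_eq, ← IsScalarTower.algebraMap_apply]
  have h1 : derivative f.num * f.denom =
      f.num * derivative f.denom + C c * f.num * f.denom := by
    apply FaithfulSMul.algebraMap_injective K[X] (RatFunc K)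
    have h2 := congrArg d hqf
    rw [d.leibniz, hd, hd, hf, smul_eq_mul, smul_eq_mul, hc] at h2
    simp only [map_mul, map_add]
    rw [← h2, ← hqf]
    ring
  have hdvd : f.denom ∣ derivative f.denom := by
    refine f.isCoprime_num_denom.symm.dvd_of_dvd_mul_left (?_ : _ ∣ f.num * _)
    exact ⟨derivative f.num - C c * f.num, by linear_combination -h1⟩
  have hden : f.denom = 1 := by
    have h0 : derivative f.denom = 0 := by
      by_contra h0
      exact (degree_derivative_lt f.denom_ne_zero).not_ge (degree_le_of_dvd hdvd h0)
    exact f.monic_denom.natDegree_eq_zero.mp (derivative_eq_zero.mp h0)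
  rw [hden, map_one, one_mul] at hqf
  rw [hden, derivative_one, mul_zero, zero_add, mul_one, mul_one] at h1
  have hnum : derivative f.num = 0 := by
    by_cases hn : f.num = 0
    · rw [hn, derivative_zero]
    by_contra h0
    exact (degree_derivative_lt hn).not_ge
      (degree_le_of_dvd ⟨C c, by rw [h1, mul_comm]⟩ h0)
  rw [eq_C_of_derivative_eq_zero hnum] at hqf
  refine ⟨f.num.coeff 0, Eq.trans ?_ hqf.symm⟩
  rw [← algebraMap_eq, ← IsScalarTower.algebraMap_apply]

/-- The case where the constants are the whole (algebraically closed) base field. -/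
theorem exists_gauge_constant [IsAlgClosed K] {n : ℕ} (d : Derivation K (RatFunc K) (RatFunc K))
    (hd : ∀ p : K[X], d (algebraMap K[X] (RatFunc K) p) =
      algebraMap K[X] (RatFunc K) (derivative p))
    (σ : RatFunc K ≃ₐ[K] RatFunc K)
    (hσ : ∀ p : K[X], σ (algebraMap K[X] (RatFunc K) p) =
      algebraMap K[X] (RatFunc K) (taylor 1 p))
    (hσd : ∀ f, σ (d f) = d (σ f)) (A B : Matrix (Fin n) (Fin n) (RatFunc K)) (hA : IsUnit A)
    (hAB : B.map σ * A = A.map d + A * B) :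
    ∃ (T : Matrix (Fin n) (Fin n) (RatFunc K)) (A0 : Matrix (Fin n) (Fin n) K),
      IsUnit T ∧ T.map σ * A = A0.map (algebraMap K (RatFunc K)) * T := by
  let D : Module.End K (Fin n → RatFunc K) :=
    { toFun := fun t => (fun i => d (t i)) + Matrix.vecMul t B
      map_add' := fun s t => by
        funext i
        simp only [Matrix.add_vecMul, Pi.add_apply, map_add]
        ring
      map_smul' := fun c t => by
        funext i
        simp only [Matrix.smul_vecMul, Pi.add_apply, Pi.smul_apply, RingHom.id_apply, smul_add]
        congr 1
        exact d.map_smul c (t i) }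
  let φ : Module.End K (Fin n → RatFunc K) :=
    { toFun := fun t => Matrix.vecMul (fun i => σ (t i)) A
      map_add' := fun s t => by
        rw [← Matrix.add_vecMul]
        congr 1
        funext i
        simp
      map_smul' := fun c t => by
        rw [RingHom.id_apply, ← Matrix.smul_vecMul]
        congr 1
        funext i
        exact σ.toLinearMap.map_smul c (t i) }
  have hDf : ∀ (f : RatFunc K) (t : Fin n → RatFunc K), D (f • t) = d f • t + f • D t := by
    intro f t
    funext i
    simp only [D, LinearMap.coe_mk, AddHom.coe_mk, Matrix.smul_vecMul, Pi.add_apply,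
      Pi.smul_apply, smul_eq_mul, d.leibniz]
    ring
  have hφf : ∀ (f : RatFunc K) (t : Fin n → RatFunc K), φ (f • t) = σ f • φ t := by
    intro f t
    simp only [φ, LinearMap.coe_mk, AddHom.coe_mk]
    rw [← Matrix.smul_vecMul]
    congr 1
    funext i
    simp
  have hD : IsConnection D := fun p t => by
    rw [← algebraMap_smul (RatFunc K) p t, hDf, hd, algebraMap_smul, algebraMap_smul]
  have hφ : ∀ (p : K[X]) (t : Fin n → RatFunc K), φ (p • t) = taylor 1 p • φ t := fun p t => by
    rw [← algebraMap_smul (RatFunc K) p t, hφf, hσ, algebraMap_smul]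
  have hcomm : Commute D φ := by
    refine LinearMap.ext fun t => ?_
    have h1 : (fun i => d (Matrix.vecMul (fun i => σ (t i)) A i)) =
        Matrix.vecMul (fun i => σ (d (t i))) A + Matrix.vecMul (fun i => σ (t i)) (A.map d) := by
      funext i
      simp only [Matrix.vecMul, dotProduct, map_sum, d.leibniz, smul_eq_mul, Pi.add_apply,
        Matrix.map_apply, hσd, ← Finset.sum_add_distrib]
      exact Finset.sum_congr rfl fun j _ => by ring
    have h2 : (fun i => σ (d (t i) + Matrix.vecMul t B i)) =
        (fun i => σ (d (t i))) + Matrix.vecMul (fun i => σ (t i)) (B.map σ) := by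
      funext i
      simp [Matrix.vecMul, dotProduct]
    simp only [D, φ, Module.End.mul_apply, LinearMap.coe_mk, AddHom.coe_mk, h1, Pi.add_apply, h2,
      Matrix.add_vecMul, Matrix.vecMul_vecMul, hAB, Matrix.vecMul_add]
    abel
  have hbij : Function.Bijective φ := by
    obtain ⟨A', hA', hA''⟩ := isUnit_iff_exists.mp hA
    refine ⟨fun s t hst => ?_, fun t => ⟨fun i => σ.symm (Matrix.vecMul t A' i), ?_⟩⟩
    · have h1 := congrArg (fun w => Matrix.vecMul w A') hst
      simp only [φ, LinearMap.coe_mk, AddHom.coe_mk, Matrix.vecMul_vecMul, hA',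
        Matrix.vecMul_one] at h1
      funext i
      exact σ.injective (congrFun h1 i)
    · simp only [φ, LinearMap.coe_mk, AddHom.coe_mk, AlgEquiv.apply_symm_apply]
      rw [Matrix.vecMul_vecMul, hA'', Matrix.vecMul_one]
  let emb : (Fin n → K[X]) →ₗ[K[X]] (Fin n → RatFunc K) :=
    (Algebra.linearMap K[X] (RatFunc K)).compLeft (Fin n)
  have htf : Module.IsTorsionFree K[X] (Fin n → RatFunc K) := by
    have : Module.IsTorsionFree K[X] (RatFunc K) := inferInstance
    infer_instance
  have hfull : ∀ v : Fin n → RatFunc K, ∃ g : K[X], g ≠ 0 ∧ g • v ∈ LinearMap.range emb := by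
    intro v
    obtain ⟨g, hg⟩ := IsLocalization.exist_integer_multiples_of_finite (nonZeroDivisors K[X]) v
    choose u hu using hg
    exact ⟨g, nonZeroDivisors.coe_ne_zero g, u, funext hu⟩
  set E : Set (Fin n → RatFunc K) := {u | ∃ μ : K, D u = μ • u} with hE
  have hspan : ⊤ ≤ Submodule.span (RatFunc K) E := by
    intro v _
    obtain ⟨g, hg, hgv⟩ := hD.exists_smul_isTorsionFor emb hfull φ hbij hφ hcomm v
    have h1 := Submodule.span_le_restrictScalars K[X] (RatFunc K) E (hD.mem_span_eigenvectors hgv)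
    rw [Submodule.restrictScalars_mem, ← algebraMap_smul (RatFunc K) g v] at h1
    exact (Submodule.smul_mem_iff _ (by simpa using hg)).mp h1
  let b0 := Module.Basis.ofSpan hspan
  let b := b0.reindex (b0.indexEquiv (Pi.basisFun (RatFunc K) (Fin n)))
  have hbE : ∀ i, b i ∈ E := fun i => by
    rw [Module.Basis.reindex_apply]
    exact Module.Basis.ofSpan_subset hspan ⟨_, rfl⟩
  choose μ hμ using hbE
  have hconst : ∀ i j, ∃ a : K, algebraMap K (RatFunc K) a = b.repr (φ (b i)) j := by
    intro i j
    refine exists_algebraMap_eq_of_derivation_eq_mul d hd (μ i - μ j) _ ?_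
    have h1 : D (φ (b i)) = μ i • φ (b i) := by
      rw [← Module.End.mul_apply, hcomm.eq, Module.End.mul_apply, hμ, map_smul]
    have h2 : ∀ w, D w = ∑ l, (d (b.repr w l) + algebraMap K (RatFunc K) (μ l) * b.repr w l) •
        b l := by
      intro w
      conv_lhs => rw [← b.sum_repr w]
      rw [map_sum]
      refine Finset.sum_congr rfl fun l _ => ?_
      rw [hDf, hμ, add_smul, mul_comm, mul_smul, algebraMap_smul]
    have h3 : b.repr (D (φ (b i))) j = d (b.repr (φ (b i)) j) +
        algebraMap K (RatFunc K) (μ j) * b.repr (φ (b i)) j := by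
      rw [h2, b.repr_sum_self]
    rw [h1, ← algebraMap_smul (RatFunc K) (μ i), map_smul, Finsupp.smul_apply, smul_eq_mul] at h3
    rw [map_sub]
    linear_combination -h3
  choose a ha using hconst
  refine ⟨Matrix.of fun i => b i, Matrix.of a, ?_, ?_⟩
  · rw [← Matrix.linearIndependent_rows_iff_isUnit]
    exact b.linearIndependent
  · ext i j
    have h1 := congrFun (b.sum_repr (φ (b i))) j
    simp only [Finset.sum_apply, Pi.smul_apply, smul_eq_mul, ← ha] at h1
    exact h1.symm

end RatFunc

section Descent

/-- The identity between polynomials obtained by clearing denominators in the integrability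
condition `σ(B) A = δ(A) + A B` for `A = a⁻¹ Q` and `B = b⁻¹ P`. -/
def ClearedIntegrability {R : Type*} [CommRing R] {n : ℕ} (a : R[X])
    (Q : Matrix (Fin n) (Fin n) R[X]) (b : R[X]) (P : Matrix (Fin n) (Fin n) R[X]) : Prop :=
  ∀ i k, a * b * ∑ j, taylor 1 (P i j) * Q j k =
    b * taylor 1 b * (a * derivative (Q i k) - derivative a * Q i k) +
      a * taylor 1 b * ∑ j, Q i j * P j k

lemma ClearedIntegrability.map {R S : Type*} [CommRing R] [CommRing S] (f : R →+* S) {n : ℕ}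
    {a b : R[X]} {P Q : Matrix (Fin n) (Fin n) R[X]} (h : ClearedIntegrability a Q b P) :
    ClearedIntegrability (a.map f) (Q.map (Polynomial.map f)) (b.map f)
      (P.map (Polynomial.map f)) := fun i k => by
  simpa [Polynomial.map_sum, ← derivative_map] using
    congrArg (Polynomial.map f) (h i k)

lemma ClearedIntegrability.of_map {R S : Type*} [CommRing R] [CommRing S] {f : R →+* S}
    (hf : Function.Injective f) {n : ℕ} {a b : R[X]} {P Q : Matrix (Fin n) (Fin n) R[X]}
    (h : ClearedIntegrability (a.map f) (Q.map (Polynomial.map f)) (b.map f)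
      (P.map (Polynomial.map f))) :
    ClearedIntegrability a Q b P := fun i k => by
  refine Polynomial.map_injective f hf ?_
  simpa [Polynomial.map_sum, ← derivative_map] using h i k

lemma clearedIntegrability_iff {R K : Type*} [CommRing R] [Field K] [Algebra R (RatFunc K)]
    {n : ℕ} {a b : K[X]} (ha : a ≠ 0) (hb : b ≠ 0) (Q P : Matrix (Fin n) (Fin n) K[X])
    (σ : RatFunc K →+* RatFunc K)
    (hσ : ∀ p, σ (algebraMap K[X] _ p) = algebraMap _ _ (taylor 1 p))
    (d : Derivation R (RatFunc K) (RatFunc K))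
    (hda : d (algebraMap K[X] _ a) = algebraMap _ _ (derivative a))
    (hdQ : ∀ i j, d (algebraMap K[X] _ (Q i j)) = algebraMap _ _ (derivative (Q i j)))
    {A B : Matrix (Fin n) (Fin n) (RatFunc K)}
    (hA : ∀ i j, A i j = algebraMap K[X] _ (Q i j) / algebraMap K[X] _ a)
    (hB : ∀ i j, B i j = algebraMap K[X] _ (P i j) / algebraMap K[X] _ b) :
    B.map σ * A = A.map d + A * B ↔ ClearedIntegrability a Q b P := by
  have ha' : algebraMap K[X] (RatFunc K) a ≠ 0 := by simpa using ha
  have hb' : algebraMap K[X] (RatFunc K) b ≠ 0 := by simpa using hb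
  have hb'' : algebraMap K[X] (RatFunc K) (taylor 1 b) ≠ 0 := by simpa using hb
  rw [← Matrix.ext_iff, ClearedIntegrability]
  refine forall_congr' fun i => forall_congr' fun k => ?_
  have h1 : (B.map σ * A) i k = (∑ j, algebraMap K[X] (RatFunc K) (taylor 1 (P i j)) *
      algebraMap K[X] _ (Q j k)) / (algebraMap K[X] _ (taylor 1 b) * algebraMap K[X] _ a) := by
    rw [Matrix.mul_apply, Finset.sum_div]
    refine Finset.sum_congr rfl fun j _ => ?_
    rw [Matrix.map_apply, hA, hB, map_div₀, hσ, hσ, div_mul_div_comm]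
  have h2 : (A * B) i k = (∑ j, algebraMap K[X] (RatFunc K) (Q i j) *
      algebraMap K[X] _ (P j k)) / (algebraMap K[X] _ a * algebraMap K[X] _ b) := by
    rw [Matrix.mul_apply, Finset.sum_div]
    refine Finset.sum_congr rfl fun j _ => ?_
    rw [hA, hB, div_mul_div_comm]
  rw [Matrix.add_apply, h1, h2, Matrix.map_apply, hA, Derivation.leibniz_div, hda, hdQ,
    ← (IsFractionRing.injective K[X] (RatFunc K)).eq_iff]
  simp only [map_mul, map_add, map_sub, map_sum, smul_eq_mul]
  constructor <;> intro h
  · field_simp at h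
    linear_combination h
  · field_simp
    linear_combination h

lemma exists_algHom_of_finiteType (K R : Type*) [Field K] [IsAlgClosed K] [CommRing R]
    [Nontrivial R] [Algebra K R] [Algebra.FiniteType K R] : Nonempty (R →ₐ[K] K) := by
  obtain ⟨m, hm⟩ := Ideal.exists_maximal R
  let _ := Ideal.Quotient.field m
  have : Algebra.FiniteType K (R ⧸ m) := inferInstance
  have : Module.Finite K (R ⧸ m) := finite_of_finite_type_of_isJacobsonRing K (R ⧸ m)
  have hbij := IsAlgClosed.algebraMap_bijective_of_isIntegral (k := K) (K := R ⧸ m)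
  exact ⟨((AlgEquiv.ofBijective (Algebra.ofId K (R ⧸ m)) hbij).symm : R ⧸ m →ₐ[K] K).comp
    (Ideal.Quotient.mkₐ K m)⟩

/-- Specialization of a solution with coefficients in an extension field. -/
lemma ClearedIntegrability.specialize {K L : Type*} [Field K] [IsAlgClosed K] [Field L]
    [Algebra K L] {n : ℕ} {a : K[X]} {Q : Matrix (Fin n) (Fin n) K[X]} {b : L[X]} (hb : b ≠ 0)
    {P : Matrix (Fin n) (Fin n) L[X]}
    (h : ClearedIntegrability (a.map (algebraMap K L)) (Q.map (Polynomial.map (algebraMap K L)))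
      b P) :
    ∃ (b₀ : K[X]) (P₀ : Matrix (Fin n) (Fin n) K[X]), b₀ ≠ 0 ∧
      ClearedIntegrability a Q b₀ P₀ := by
  classical
  let s : Finset L := insert b.leadingCoeff⁻¹
    (b.coeffs ∪ Finset.univ.biUnion fun ij : Fin n × Fin n => (P ij.1 ij.2).coeffs)
  let R := Algebra.adjoin K (s : Set L)
  have hR : Algebra.FiniteType K R := (Subalgebra.fg_iff_finiteType _).mp ⟨s, rfl⟩
  obtain ⟨χ⟩ := exists_algHom_of_finiteType K R
  have hmem : ∀ p : L[X], p.coeffs ⊆ s → p ∈ Polynomial.lifts (algebraMap R L) := by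
    intro p hp
    rw [Polynomial.lifts_iff_coeff_lifts]
    intro i
    by_cases hi : p.coeff i = 0
    · exact ⟨0, by rw [hi, map_zero]⟩
    · exact ⟨⟨p.coeff i, Algebra.subset_adjoin (hp (coeff_mem_coeffs hi))⟩, rfl⟩
  obtain ⟨b', hb'⟩ := (Polynomial.mem_lifts _).mp (hmem b fun x hx => by simp [s, hx])
  have hP : ∀ i j, ∃ p : R[X], p.map (algebraMap R L) = P i j := fun i j =>
    (Polynomial.mem_lifts _).mp (hmem (P i j) fun x hx =>
      Finset.mem_insert_of_mem (Finset.mem_union_right _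
        (Finset.mem_biUnion.mpr ⟨(i, j), Finset.mem_univ _, hx⟩)))
  choose P' hP' using hP
  have hinj : Function.Injective (algebraMap R L) := Subtype.val_injective
  have h' : ClearedIntegrability (a.map (algebraMap K R))
      (Q.map (Polynomial.map (algebraMap K R))) b' (Matrix.of P') := by
    refine ClearedIntegrability.of_map hinj ?_
    convert h
    · rw [Polynomial.map_map, ← IsScalarTower.algebraMap_eq]
    · ext i j : 2
      simp only [Matrix.map_apply]
      rw [Polynomial.map_map, ← IsScalarTower.algebraMap_eq]
    · ext i j : 2
      simp [hP']
  have hχ : (χ : R →+* K).comp (algebraMap K R) = RingHom.id K := by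
    ext x
    simp
  refine ⟨b'.map (χ : R →+* K), (Matrix.of P').map (Polynomial.map (χ : R →+* K)), ?_, ?_⟩
  · intro h0
    let u : R := ⟨b.leadingCoeff⁻¹, Algebra.subset_adjoin (by simp [s])⟩
    have hu : u * b'.coeff b.natDegree = 1 := by
      refine hinj ?_
      rw [map_mul, ← Polynomial.coeff_map, hb', map_one]
      exact inv_mul_cancel₀ (leadingCoeff_ne_zero.mpr hb)
    have h1 := congrArg (fun p => coeff p b.natDegree) h0
    simp only [Polynomial.coeff_map, coeff_zero] at h1
    have h2 := congrArg (χ : R →+* K) hu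
    rw [map_mul, h1, mul_zero, map_one] at h2
    exact zero_ne_one h2
  · convert h'.map (χ : R →+* K)
    · rw [Polynomial.map_map, hχ, Polynomial.map_id]
    · ext i j : 2
      simp only [Matrix.map_apply]
      rw [Polynomial.map_map, hχ, Polynomial.map_id]

lemma exists_ratFunc_map (K L : Type*) [Field K] [Field L] [Algebra K L] :
    ∃ ι : RatFunc K →+* RatFunc L, ∀ p : K[X],
      ι (algebraMap _ _ p) = algebraMap _ _ (p.map (algebraMap K L)) := by
  have hinj : Function.Injective ((algebraMap L[X] (RatFunc L)).comp
      (mapRingHom (algebraMap K L))) :=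
    (IsFractionRing.injective L[X] (RatFunc L)).comp
      (Polynomial.map_injective _ (algebraMap K L).injective)
  exact ⟨IsFractionRing.lift hinj, fun p => IsFractionRing.lift_algebraMap hinj p⟩

/-- A derivation of `L(x)` that extends the derivative on `K[x]` restricts to `K(x)`. -/
lemma exists_derivation_restrict {K L : Type*} [Field K] [Field L] [Algebra K L]
    (ι : RatFunc K →+* RatFunc L)
    (Δ : Derivation K (RatFunc L) (RatFunc L))
    (hΔ : ∀ p : K[X], Δ (ι (algebraMap _ _ p)) = ι (algebraMap _ _ (derivative p))) :
    ∃ d : Derivation K (RatFunc K) (RatFunc K), ∀ f, ι (d f) = Δ (ι f) := by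
  have hex : ∀ f, ∃ g, ι g = Δ (ι f) := by
    intro f
    obtain ⟨p, q, -, rfl⟩ := IsFractionRing.div_surjective K[X] f
    rw [map_div₀, Derivation.leibniz_div, hΔ, hΔ]
    simp only [smul_eq_mul]
    simp only [← map_mul, ← map_sub, ← map_inv₀, ← map_pow]
    exact ⟨_, rfl⟩
  choose d hd using hex
  have hC : ∀ c : K, Δ (ι (algebraMap K (RatFunc K) c)) = 0 := fun c => by
    rw [IsScalarTower.algebraMap_apply K K[X] (RatFunc K), hΔ]
    simp
  refine ⟨Derivation.mk'
    { toFun := d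
      map_add' := fun x y => ι.injective (by simp [hd])
      map_smul' := fun c x => ι.injective (by
        rw [hd, RingHom.id_apply, Algebra.smul_def, Algebra.smul_def, map_mul ι, map_mul ι,
          Derivation.leibniz, hC, hd]
        simp) } fun x y => ι.injective ?_, hd⟩
  simp [hd]

lemma exists_common_denominator {K : Type*} [Field K] {n : ℕ}
    (M : Matrix (Fin n) (Fin n) (RatFunc K)) :
    ∃ (a : K[X]) (Q : Matrix (Fin n) (Fin n) K[X]), a ≠ 0 ∧
      ∀ i j, M i j = algebraMap K[X] _ (Q i j) / algebraMap K[X] _ a := by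
  obtain ⟨a, ha⟩ := IsLocalization.exist_integer_multiples_of_finite (nonZeroDivisors K[X])
    fun ij : Fin n × Fin n => M ij.1 ij.2
  choose Q hQ using ha
  have ha0 : (a : K[X]) ≠ 0 := nonZeroDivisors.coe_ne_zero a
  refine ⟨a, Matrix.of fun i j => Q (i, j), ha0, fun i j => ?_⟩
  rw [Matrix.of_apply, hQ, eq_div_iff (by simp), Algebra.smul_def, mul_comm]

/-- An integrability matrix over `L(x)` for a system over `K(x)` can be chosen over `K(x)`. -/
lemma exists_integrability_matrix {K L : Type*} [Field K] [IsAlgClosed K] [Field L] [Algebra K L]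
    {n : ℕ} (ι : RatFunc K →+* RatFunc L)
    (hι : ∀ p : K[X], ι (algebraMap _ _ p) = algebraMap _ _ (p.map (algebraMap K L)))
    (σ₀ : RatFunc K →+* RatFunc K)
    (hσ₀ : ∀ p : K[X], σ₀ (algebraMap _ _ p) = algebraMap _ _ (taylor 1 p))
    (σ : RatFunc L →+* RatFunc L)
    (hσ : ∀ p : L[X], σ (algebraMap _ _ p) = algebraMap _ _ (taylor 1 p))
    (d : Derivation K (RatFunc K) (RatFunc K))
    (hd : ∀ p : K[X], d (algebraMap _ _ p) = algebraMap _ _ (derivative p))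
    (Δ : Derivation K (RatFunc L) (RatFunc L)) (hdΔ : ∀ f, ι (d f) = Δ (ι f))
    (A : Matrix (Fin n) (Fin n) (RatFunc K)) (B : Matrix (Fin n) (Fin n) (RatFunc L))
    (hAB : B.map σ * A.map ι = (A.map ι).map Δ + A.map ι * B) :
    ∃ B₀ : Matrix (Fin n) (Fin n) (RatFunc K), B₀.map σ₀ * A = A.map d + A * B₀ := by
  obtain ⟨a, Q, ha, hA⟩ := exists_common_denominator A
  obtain ⟨b, P, hb, hB⟩ := exists_common_denominator B
  have hΔ : ∀ p : K[X], Δ (algebraMap L[X] _ (p.map (algebraMap K L))) =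
      algebraMap L[X] _ (derivative (p.map (algebraMap K L))) := fun p => by
    rw [derivative_map, ← hι, ← hι, ← hdΔ, hd]
  have h := (clearedIntegrability_iff
    ((Polynomial.map_ne_zero_iff (algebraMap K L).injective).mpr ha) hb
    (Q.map (Polynomial.map (algebraMap K L))) P σ hσ Δ (hΔ a) (fun i j => hΔ (Q i j))
    (A := A.map ι) (fun i j => by simp [hA, hι]) hB).mp hAB
  obtain ⟨b₀, P₀, hb₀, h₀⟩ := h.specialize hb
  exact ⟨Matrix.of fun i j => algebraMap K[X] _ (P₀ i j) / algebraMap K[X] _ b₀,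
    (clearedIntegrability_iff ha hb₀ Q P₀ σ₀ hσ₀ d (hd a) (fun i j => hd (Q i j)) hA
      fun _ _ => rfl).mpr h₀⟩

end Descent

end ShiftIntegrable

/-- Shift case of the integrability reduction (after Schäfke–Singer).  Let `C₀` be
algebraically closed of characteristic zero, `C ⊇ C₀` a field with a derivation `δ` whose
constants are exactly `C₀`, extended to `k = C(x)` by `δ(x) = 1`, and let `σ` be the shift
`x ↦ x + 1`.  If `σ(Y) = AY` with `A ∈ GL_n(C₀(x))` is integrable, i.e. there is `B` over `k`
with `σ(B) = ABA⁻¹ + δ(A)A⁻¹`, then the system is gauge-equivalent over `k` to a system with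
constant coefficient matrix in `GL_n(C₀)`. -/
theorem shift_integrable_reduction {C0 C : Type*}
    [Field C0] [IsAlgClosed C0] [CharZero C0] [Field C] [Algebra C0 C]
    (δ : C → C)
    (hδadd : ∀ x y, δ (x + y) = δ x + δ y)
    (hδmul : ∀ x y, δ (x * y) = δ x * y + x * δ y)
    (hδconst : ∀ c : C, δ c = 0 ↔ ∃ c0 : C0, algebraMap C0 C c0 = c)
    (σ : RatFunc C →ₐ[C] RatFunc C) (hσ : σ RatFunc.X = RatFunc.X + 1)
    (Δ : RatFunc C → RatFunc C)
    (hΔadd : ∀ x y, Δ (x + y) = Δ x + Δ y)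
    (hΔmul : ∀ x y, Δ (x * y) = Δ x * y + x * Δ y)
    (hΔC : ∀ c : C, Δ (algebraMap C (RatFunc C) c) = algebraMap C (RatFunc C) (δ c))
    (hΔX : Δ RatFunc.X = 1)
    (hσΔ : ∀ f, σ (Δ f) = Δ (σ f))
    (n : ℕ) (A : (Matrix (Fin n) (Fin n) (RatFunc C))ˣ)
    -- each entry of `A` lies in `C₀(x)`: it is a ratio of polynomials with `C₀`-coefficients
    (hA : ∀ i j, ∃ p q : Polynomial C0, q ≠ 0 ∧
      (A : Matrix (Fin n) (Fin n) (RatFunc C)) i j *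
          algebraMap (Polynomial C) (RatFunc C) (q.map (algebraMap C0 C)) =
        algebraMap (Polynomial C) (RatFunc C) (p.map (algebraMap C0 C)))
    (B : Matrix (Fin n) (Fin n) (RatFunc C))
    (hB : B.map ⇑σ =
      (A : Matrix (Fin n) (Fin n) (RatFunc C)) * B *
          ((A⁻¹ : (Matrix (Fin n) (Fin n) (RatFunc C))ˣ) : Matrix (Fin n) (Fin n) (RatFunc C)) +
        ((A : Matrix (Fin n) (Fin n) (RatFunc C)).map Δ) *
          ((A⁻¹ : (Matrix (Fin n) (Fin n) (RatFunc C))ˣ) : Matrix (Fin n) (Fin n) (RatFunc C))) :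
    ∃ T : (Matrix (Fin n) (Fin n) (RatFunc C))ˣ, ∃ A0 : Matrix (Fin n) (Fin n) C0,
      ((T : Matrix (Fin n) (Fin n) (RatFunc C)).map ⇑σ) *
          (A : Matrix (Fin n) (Fin n) (RatFunc C)) *
          ((T⁻¹ : (Matrix (Fin n) (Fin n) (RatFunc C))ˣ) : Matrix (Fin n) (Fin n) (RatFunc C)) =
        A0.map (fun c => algebraMap C (RatFunc C) (algebraMap C0 C c)) := by
  classical
  have hσp : ∀ p : Polynomial C, σ (algebraMap (Polynomial C) (RatFunc C) p) =
      algebraMap (Polynomial C) (RatFunc C) (Polynomial.taylor 1 p) := by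
    have h : σ.comp (IsScalarTower.toAlgHom C (Polynomial C) (RatFunc C)) =
        (IsScalarTower.toAlgHom C (Polynomial C) (RatFunc C)).comp
          (Polynomial.taylorAlgHom 1) := by
      ext
      simp [hσ]
    exact fun p => DFunLike.congr_fun h p
  let D : Derivation C0 (RatFunc C) (RatFunc C) :=
    Derivation.mk'
      { toFun := Δ
        map_add' := hΔadd
        map_smul' := fun c x => by
          rw [algebra_compatible_smul C c, Algebra.smul_def, hΔmul, hΔC,
            (hδconst _).mpr ⟨c, rfl⟩, map_zero, zero_mul, zero_add, RingHom.id_apply,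
            algebra_compatible_smul C c (Δ x), Algebra.smul_def] } fun x y => by
      simp only [LinearMap.coe_mk, AddHom.coe_mk, hΔmul, smul_eq_mul]
      ring
  have hDΔ : ∀ f, D f = Δ f := fun f => rfl
  obtain ⟨ι, hι⟩ := ShiftIntegrable.exists_ratFunc_map C0 C
  have hDp : ∀ p : Polynomial C0, D (ι (algebraMap _ _ p)) =
      ι (algebraMap _ _ (Polynomial.derivative p)) := by
    have hX : D (algebraMap (Polynomial C) _ Polynomial.X) = 1 := by
      rw [RatFunc.algebraMap_X, hDΔ, hΔX]
    have hC : ∀ c : C0, D (algebraMap (Polynomial C) _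
        (Polynomial.C (algebraMap C0 C c))) = 0 := fun c => by
      rw [← Polynomial.algebraMap_eq, ← IsScalarTower.algebraMap_apply, hDΔ, hΔC,
        (hδconst _).mpr ⟨c, rfl⟩, map_zero]
    intro p
    induction p using Polynomial.induction_on' with
    | add p q hp hq => simp only [map_add, hp, hq]
    | monomial m c =>
      rw [hι, hι, ← Polynomial.C_mul_X_pow_eq_monomial, Polynomial.derivative_C_mul_X_pow]
      simp only [Polynomial.map_mul, Polynomial.map_pow, Polynomial.map_C, Polynomial.map_X,
        Polynomial.map_natCast, map_mul, map_pow, map_natCast, Derivation.leibniz,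
        Derivation.leibniz_pow, hX, hC, smul_eq_mul, nsmul_eq_mul, mul_zero, add_zero, mul_one,
        mul_assoc]
  obtain ⟨d, hd⟩ := ShiftIntegrable.exists_derivation_restrict ι D hDp
  have hdp : ∀ p : Polynomial C0, d (algebraMap _ _ p) =
      algebraMap _ _ (Polynomial.derivative p) := fun p => ι.injective (by rw [hd, hDp])
  let σ₀ : RatFunc C0 ≃ₐ[C0] RatFunc C0 :=
    IsFractionRing.algEquivOfAlgEquiv (Polynomial.taylorEquiv 1)
  have hσ₀ : ∀ p : Polynomial C0, σ₀ (algebraMap _ _ p) =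
      algebraMap _ _ (Polynomial.taylor 1 p) := fun p =>
    IsFractionRing.algEquivOfAlgEquiv_algebraMap (Polynomial.taylorEquiv 1) p
  have hσι : ∀ f, ι (σ₀ f) = σ (ι f) := by
    intro f
    obtain ⟨p, q, -, rfl⟩ := IsFractionRing.div_surjective (Polynomial C0) f
    simp only [map_div₀, hσ₀, hι, hσp, Polynomial.map_taylor, map_one]
  have hσ₀d : ∀ f, σ₀ (d f) = d (σ₀ f) := fun f => ι.injective (by
    rw [hσι, hd, hd, hσι, hDΔ, hDΔ, hσΔ])
  choose p q hq hpq using hA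
  let A₀ : Matrix (Fin n) (Fin n) (RatFunc C0) :=
    Matrix.of fun i j => algebraMap _ _ (p i j) / algebraMap _ _ (q i j)
  have hA₀ij : ∀ i j, A₀ i j = algebraMap _ _ (p i j) / algebraMap _ _ (q i j) := fun _ _ => rfl
  have hA₀ : A₀.map ι = A := by
    ext i j
    have hq' : algebraMap (Polynomial C) (RatFunc C) ((q i j).map (algebraMap C0 C)) ≠ 0 := by
      simpa [Polynomial.map_eq_zero_iff (algebraMap C0 C).injective] using hq i j
    rw [Matrix.map_apply, hA₀ij, map_div₀, hι, hι, div_eq_iff hq', hpq]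
  have hA₀u : IsUnit A₀ := by
    rw [Matrix.isUnit_iff_isUnit_det, isUnit_iff_ne_zero]
    intro h0
    have h1 : IsUnit (A₀.map ι) := hA₀ ▸ A.isUnit
    rw [Matrix.isUnit_iff_isUnit_det, isUnit_iff_ne_zero] at h1
    refine h1 ?_
    rw [← RingHom.mapMatrix_apply, ← RingHom.map_det, h0, map_zero]
  have hAB : B.map σ * A.val = A.val.map D + A.val * B := by
    rw [hB, add_mul, Units.inv_mul_cancel_right, Units.inv_mul_cancel_right, add_comm]
    rfl
  obtain ⟨B₀, hB₀⟩ := ShiftIntegrable.exists_integrability_matrix ι hι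
    (σ₀ : RatFunc C0 →+* RatFunc C0) hσ₀ (σ : RatFunc C →+* RatFunc C) hσp d hdp D hd A₀ B (by
      rw [hA₀]
      exact hAB)
  obtain ⟨T₀, M, hT₀, hTM⟩ :=
    ShiftIntegrable.exists_gauge_constant d hdp σ₀ hσ₀ hσ₀d A₀ B₀ hA₀u hB₀
  have hTu : IsUnit (T₀.map ι) := hT₀.map ι.mapMatrix
  refine ⟨hTu.unit, M, ?_⟩
  rw [Units.mul_inv_eq_iff_eq_mul]
  have h := congrArg ι.mapMatrix hTM
  rw [map_mul, map_mul] at h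
  simp only [RingHom.mapMatrix_apply, hA₀] at h
  have hσT : (T₀.map σ₀).map ι = (T₀.map ι).map σ := Matrix.ext fun i j => hσι (T₀ i j)
  have hM : (M.map (algebraMap C0 (RatFunc C0))).map ι =
      M.map fun c => algebraMap C (RatFunc C) (algebraMap C0 C c) := by
    refine Matrix.ext fun i j => ?_
    simp only [Matrix.map_apply]
    rw [IsScalarTower.algebraMap_apply C0 (Polynomial C0) (RatFunc C0), hι,
      IsScalarTower.algebraMap_apply C (Polynomial C) (RatFunc C), Polynomial.algebraMap_eq,
      Polynomial.map_C, Polynomial.algebraMap_eq]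
  rwa [hσT, hM] at h
end

section
/- (q-dilation case of the integrability reduction.) Let C_0 be an algebraically closed field of characteristic zero, let q ∈ C_0ˣ not be a root of unity, let C be a field extension of C_0, and let δ : C → C be a derivation whose field of constants {c ∈ C : δ(c) = 0} equals C_0. Extend δ to the rational function field k = C(x) by δ(x) = x, and let σ be the C-algebra automorphism of k with σ(x) = qx (so that σ∘δ = δ∘σ on k); apply σ and δ to matrices entrywise. Let A ∈ GL_n(C_0(x)), viewed inside GL_n(k). If there exists B ∈ M_n(k) such that σ(B) = A B A^{-1} + δ(A) A^{-1}, then there exists T ∈ GL_n(k) such that σ(T)·A·T^{-1} ∈ GL_n(C_0), i.e., the system σ(Y) = AY is gauge-equivalent over k to a system with constant coefficient matrix. -/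
namespace QDilation

open Polynomial

section Torsion

variable {F M : Type*} [Field F] [AddCommGroup M] [Module F M]

/-- The vectors annihilated by some nonzero polynomial in the endomorphism `f`. -/
def polyTorsion (f : Module.End F M) : Submodule F M where
  carrier := {v | ∃ s : F[X], s ≠ 0 ∧ aeval f s v = 0}
  zero_mem' := ⟨1, one_ne_zero, by simp⟩
  add_mem' := by
    rintro v w ⟨s, hs, hv⟩ ⟨t, ht, hw⟩
    refine ⟨s * t, mul_ne_zero hs ht, ?_⟩
    have h1 : aeval f (s * t) v = 0 := by
      rw [mul_comm, map_mul, Module.End.mul_apply, hv, map_zero]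
    have h2 : aeval f (s * t) w = 0 := by
      rw [map_mul, Module.End.mul_apply, hw, map_zero]
    rw [map_add, h1, h2, add_zero]
  smul_mem' := by
    rintro c v ⟨s, hs, hv⟩
    exact ⟨s, hs, by rw [map_smul, hv, smul_zero]⟩

theorem commute_aeval {f g : Module.End F M} (h : Commute f g) (s : F[X]) :
    Commute (aeval f s) g :=
  (Algebra.commute_of_mem_adjoin_singleton_of_commute
    (aeval_mem_adjoin_singleton F f) h.symm).symm

theorem apply_mem_polyTorsion {f g : Module.End F M} (h : Commute f g) {v : M}
    (hv : v ∈ polyTorsion f) : g v ∈ polyTorsion f := by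
  obtain ⟨s, hs, hv⟩ := hv
  exact ⟨s, hs, by
    rw [← Module.End.mul_apply, (commute_aeval h s).eq, Module.End.mul_apply, hv, map_zero]⟩

theorem mem_polyTorsion_of_aeval_mem {f : Module.End F M} {v : M} {s : F[X]} (hs : s ≠ 0)
    (h : aeval f s v ∈ polyTorsion f) : v ∈ polyTorsion f := by
  obtain ⟨t, ht, hv⟩ := h
  exact ⟨t * s, mul_ne_zero ht hs, by rw [map_mul, Module.End.mul_apply, hv]⟩

/-- A finite family is independent over the polynomials in `f`. -/
def PolyIndependent (f : Module.End F M) {l : ℕ} (u : Fin l → M) : Prop :=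
  ∀ s : Fin l → F[X], ∑ j, aeval f (s j) (u j) = 0 → s = 0

/-- Evaluation of polynomials in two commuting endomorphisms. -/
noncomputable def evalTwo {f g : Module.End F M} (h : Commute f g) : F[X][X] →+* Module.End F M :=
  eval₂RingHom' (aeval f : F[X] →ₐ[F] Module.End F M).toRingHom g fun s => commute_aeval h s

theorem evalTwo_C {f g : Module.End F M} (h : Commute f g) (s : F[X]) :
    evalTwo h (C s) = aeval f s := by
  simp [evalTwo, eval₂RingHom']

theorem evalTwo_X {f g : Module.End F M} (h : Commute f g) :
    evalTwo h X = g := by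
  simp [evalTwo, eval₂RingHom']

theorem evalTwo_monomial {f g : Module.End F M} (h : Commute f g) (i : ℕ) (s : F[X]) (v : M) :
    evalTwo h (monomial i s) v = aeval f s ((g ^ i) v) := by
  rw [← C_mul_X_pow_eq_monomial, map_mul, map_pow, evalTwo_X, evalTwo_C, Module.End.mul_apply]

theorem commute_evalTwo {f g : Module.End F M} (h : Commute f g) (P : F[X][X]) :
    Commute f (evalTwo h P) := by
  have := (Commute.all (C (X : F[X])) P).map (evalTwo h)
  rwa [evalTwo_C, aeval_X] at this

/-- The substitution `t ↦ t + 1`, `y ↦ q y`. -/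
noncomputable def twist (q : F) : F[X][X] →+* F[X][X] :=
  eval₂RingHom (C.comp (compRingHom (X + 1))) (C (C q) * X)

theorem coeff_twist (q : F) (P : F[X][X]) (i : ℕ) :
    (twist q P).coeff i = C (q ^ i) * (P.coeff i).comp (X + 1) := by
  induction P using Polynomial.induction_on' with
  | add p r hp hr => rw [map_add, coeff_add, hp, hr, coeff_add, add_comp, mul_add]
  | monomial n a =>
    have : twist q (monomial n a) = C (C (q ^ n) * a.comp (X + 1)) * X ^ n := by
      simp only [twist, coe_eval₂RingHom, eval₂_monomial, RingHom.comp_apply, coe_compRingHom_apply,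
        mul_pow, C_mul, C_pow]
      ring
    rw [this, coeff_C_mul_X_pow, coeff_monomial]
    by_cases hi : i = n
    · subst hi; simp
    · simp [hi, Ne.symm hi]

theorem aeval_apply_shift {f x : Module.End F M} (hfx : ∀ v, f (x v) = x (f v + v)) (s : F[X])
    (v : M) : aeval f s (x v) = x (aeval f (s.comp (X + 1)) v) := by
  induction s using Polynomial.induction_on generalizing v with
  | C a => simp
  | add p r hp hr => simp [hp, hr]
  | monomial n a ih =>
    rw [pow_succ, ← mul_assoc, map_mul, Module.End.mul_apply, aeval_X, hfx, ih, mul_comp,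
      map_mul, Module.End.mul_apply]
    simp

theorem evalTwo_apply_shift {f g x : Module.End F M} (h : Commute f g) {q : F}
    (hfx : ∀ v, f (x v) = x (f v + v)) (hgx : ∀ v, g (x v) = q • x (g v)) (P : F[X][X]) (v : M) :
    evalTwo h P (x v) = x (evalTwo h (twist q P) v) := by
  have hpow : ∀ n, (g ^ n) (x v) = q ^ n • x ((g ^ n) v) := by
    intro n
    induction n with
    | zero => simp
    | succ n ih =>
      rw [pow_succ', Module.End.mul_apply, ih, map_smul, hgx, smul_smul, pow_succ,
        Module.End.mul_apply]
  induction P using Polynomial.induction_on' with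
  | add p r hp hr => simp only [map_add, LinearMap.add_apply, hp, hr]
  | monomial n a =>
    have : twist q (monomial n a) = monomial n (C (q ^ n) * a.comp (X + 1)) := by
      ext1 i
      rw [coeff_twist, coeff_monomial, coeff_monomial]
      split_ifs with hi
      · rw [hi]
      · simp
    rw [this, evalTwo_monomial, evalTwo_monomial, hpow, map_smul, aeval_apply_shift hfx,
      map_mul, Module.End.mul_apply, aeval_C, Module.algebraMap_end_apply, map_smul]

theorem leadingCoeff_comp_X_add_one (s : F[X]) :
    (s.comp (X + 1)).leadingCoeff = s.leadingCoeff := by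
  rw [leadingCoeff_comp (by rw [← C_1, natDegree_X_add_C]; exact one_ne_zero)]
  simp [← C_1, -map_one]

theorem comp_X_add_one_ne_zero {s : F[X]} (hs : s ≠ 0) : s.comp (X + 1) ≠ 0 := by
  rwa [← leadingCoeff_ne_zero, leadingCoeff_comp_X_add_one, leadingCoeff_ne_zero]

theorem shift_mem_polyTorsion_of {f x : Module.End F M} (hfx : ∀ v, f (x v) = x (f v + v))
    (hx : Function.Injective x) {v : M} (hv : x v ∈ polyTorsion f) : v ∈ polyTorsion f := by
  obtain ⟨s, hs, hv⟩ := hv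
  rw [aeval_apply_shift hfx, map_eq_zero_iff _ hx] at hv
  exact ⟨_, comp_X_add_one_ne_zero hs, hv⟩

/-- A nonzero ideal of two-variable polynomials invariant under `t ↦ t + 1`, `y ↦ q y` contains
a nonzero polynomial of the form `c(t) y ^ d`. -/
theorem exists_monomial_mem_of_twist_mem {q : F} (hq0 : q ≠ 0)
    (hq : ∀ m : ℕ, 0 < m → q ^ m ≠ 1) {I : Ideal F[X][X]} (hI : I ≠ ⊥)
    (htw : ∀ P ∈ I, twist q P ∈ I) : ∃ d : ℕ, ∃ c : F[X], c ≠ 0 ∧ monomial d c ∈ I := by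
  classical
  obtain ⟨P₀, hP₀, hP₀0⟩ := Submodule.exists_mem_ne_zero_of_ne_bot hI
  have hex : ∃ d : ℕ, ∃ P ∈ I, P ≠ 0 ∧ P.natDegree = d := ⟨_, P₀, hP₀, hP₀0, rfl⟩
  obtain ⟨P, hPI, hP0, hPd⟩ := Nat.find_spec hex
  have hmin : ∀ Q ∈ I, Q.natDegree < P.natDegree → Q = 0 := by
    intro Q hQ hlt
    by_contra hQ0
    exact Nat.find_min hex (hPd ▸ hlt) ⟨Q, hQ, hQ0, rfl⟩
  set d := P.natDegree with hd
  set c := P.coeff d with hc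
  have hc0 : c ≠ 0 := by rw [hc, hd, coeff_natDegree]; exact leadingCoeff_ne_zero.2 hP0
  set Q : F[X][X] := C c * twist q P - C (C (q ^ d) * c.comp (X + 1)) * P with hQ
  have hQI : Q ∈ I := I.sub_mem (I.mul_mem_left _ (htw P hPI)) (I.mul_mem_left _ hPI)
  have hcoeff : ∀ i, Q.coeff i = c * (C (q ^ i) * (P.coeff i).comp (X + 1)) -
      C (q ^ d) * c.comp (X + 1) * P.coeff i := by
    intro i
    rw [hQ, coeff_sub, coeff_C_mul, coeff_C_mul, coeff_twist]
  have hQ0 : Q = 0 := by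
    by_contra hne
    have hle : Q.natDegree ≤ d := by
      rw [natDegree_le_iff_coeff_eq_zero]
      intro i hi
      rw [hcoeff, coeff_eq_zero_of_natDegree_lt hi]
      simp
    rcases hle.lt_or_eq with h | h
    · exact hne (hmin Q hQI h)
    · have := hcoeff d
      rw [← h, coeff_natDegree, h, ← hc] at this
      exact hne (leadingCoeff_eq_zero.1 (by rw [this]; ring))
  have hpow : ∀ i, i ≠ d → q ^ i ≠ q ^ d := by
    intro i hi he
    rcases lt_or_gt_of_ne hi with h | h
    · refine hq (d - i) (by omega) ?_
      rw [pow_sub₀ _ hq0 h.le, ← he, mul_inv_cancel₀ (pow_ne_zero _ hq0)]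
    · refine hq (i - d) (by omega) ?_
      rw [pow_sub₀ _ hq0 h.le, ← he, mul_inv_cancel₀ (pow_ne_zero _ hq0)]
  have hzero : ∀ i, i ≠ d → P.coeff i = 0 := by
    intro i hi
    by_contra hne
    have h1 := hcoeff i
    rw [hQ0, coeff_zero] at h1
    have h2 := congrArg leadingCoeff (sub_eq_zero.1 h1.symm)
    simp only [leadingCoeff_mul, leadingCoeff_C, leadingCoeff_comp_X_add_one] at h2
    have h3 := leadingCoeff_ne_zero.2 hc0
    have h4 := leadingCoeff_ne_zero.2 hne
    apply hpow i hi
    have : (q ^ i - q ^ d) * (c.leadingCoeff * (P.coeff i).leadingCoeff) = 0 := by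
      linear_combination h2
    rcases mul_eq_zero.1 this with h | h
    · exact sub_eq_zero.1 h
    · exact absurd h (mul_ne_zero h3 h4)
  refine ⟨d, c, hc0, ?_⟩
  convert hPI using 1
  ext1 i
  rw [coeff_monomial]
  split_ifs with h
  · rw [← h]
  · rw [hzero i (Ne.symm h)]

/-- If the family sizes independent over the polynomials in `f` are bounded on `N`, then one
polynomial in `f` and `g` maps `N` into the torsion. -/
theorem exists_evalTwo_mem_polyTorsion {f g : Module.End F M} (h : Commute f g)
    {N : Submodule F M} (hg : ∀ v ∈ N, g v ∈ N) {L : ℕ}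
    (hL : ∀ (l : ℕ) (u : Fin l → M), (∀ j, u j ∈ N) → PolyIndependent f u → l ≤ L) :
    ∃ P : F[X][X], P ≠ 0 ∧ ∀ v ∈ N, evalTwo h P v ∈ polyTorsion f := by
  classical
  have hgpow : ∀ i : ℕ, ∀ v ∈ N, (g ^ i) v ∈ N := by
    intro i
    induction i with
    | zero => simp
    | succ i ih => intro v hv; rw [pow_succ', Module.End.mul_apply]; exact hg _ (ih v hv)
  obtain ⟨l, ⟨w, hwN, hw⟩, hmax⟩ : ∃ l, (∃ w : Fin l → M, (∀ j, w j ∈ N) ∧ PolyIndependent f w) ∧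
      ∀ u : Fin (l + 1) → M, (∀ j, u j ∈ N) → ¬ PolyIndependent f u := by
    by_contra! hcon
    have : ∀ l, ∃ w : Fin l → M, (∀ j, w j ∈ N) ∧ PolyIndependent f w := by
      intro l
      induction l with
      | zero => exact ⟨Fin.elim0, fun j => j.elim0, fun s _ => Subsingleton.elim _ _⟩
      | succ l ih =>
        exact hcon l ih
    obtain ⟨w, hw1, hw2⟩ := this (L + 1)
    exact absurd (hL _ w hw1 hw2) (by omega)
  have hann : ∀ v ∈ N, ∃ P : F[X][X], P ≠ 0 ∧ evalTwo h P v = 0 := by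
    intro v hv
    have := hmax (fun i => (g ^ (i : ℕ)) v) (fun i => hgpow i v hv)
    simp only [PolyIndependent, not_forall] at this
    obtain ⟨s, hs, hs0⟩ := this
    refine ⟨∑ i : Fin (l + 1), monomial (i : ℕ) (s i), ?_, ?_⟩
    · intro h0
      apply hs0
      funext i
      have := congrArg (fun P => coeff P (i : ℕ)) h0
      simp only [finsetSum_coeff, coeff_monomial, coeff_zero, Fin.val_inj] at this
      simpa using this
    · rw [map_sum, LinearMap.sum_apply]
      simpa only [evalTwo_monomial] using hs
  choose! Q hQ0 hQ using hann
  refine ⟨∏ j, Q (w j), Finset.prod_ne_zero_iff.2 fun j _ => hQ0 _ (hwN j), fun v hv => ?_⟩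
  have hkill : ∀ j, evalTwo h (∏ j, Q (w j)) (w j) = 0 := by
    intro j
    rw [← Finset.prod_erase_mul _ _ (Finset.mem_univ j), map_mul, Module.End.mul_apply,
      hQ _ (hwN j), map_zero]
  have hdep := hmax (Fin.snoc w v) (fun j => by
    refine Fin.lastCases ?_ (fun i => ?_) j
    · simpa using hv
    · simpa using hwN i)
  simp only [PolyIndependent, not_forall, Fin.sum_univ_castSucc, Fin.snoc_castSucc,
    Fin.snoc_last] at hdep
  obtain ⟨s, hs, hs0⟩ := hdep
  have hlast : s (Fin.last l) ≠ 0 := by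
    intro h0
    apply hs0
    rw [h0, map_zero, LinearMap.zero_apply, add_zero] at hs
    have := hw (fun j => s j.castSucc) hs
    funext j
    refine Fin.lastCases h0 (fun i => congrFun this i) j
  refine mem_polyTorsion_of_aeval_mem hlast ⟨1, one_ne_zero, ?_⟩
  have hc : ∀ (s : F[X]) (v : M),
      aeval f s (evalTwo h (∏ j, Q (w j)) v) = evalTwo h (∏ j, Q (w j)) (aeval f s v) := by
    intro s v
    rw [← Module.End.mul_apply, (commute_aeval (commute_evalTwo h _) s).eq,
      Module.End.mul_apply]
  rw [map_one, Module.End.one_apply, hc, eq_neg_of_add_eq_zero_right hs, map_neg, map_sum,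
    neg_eq_zero]
  refine Finset.sum_eq_zero fun j _ => ?_
  rw [← hc, hkill, map_zero]

theorem le_polyTorsion {f g x : Module.End F M} (h : Commute f g) {q : F} (hq0 : q ≠ 0)
    (hq : ∀ m : ℕ, 0 < m → q ^ m ≠ 1)
    (hfx : ∀ v, f (x v) = x (f v + v)) (hgx : ∀ v, g (x v) = q • x (g v))
    (hxinj : Function.Injective x) (hginj : Function.Injective g)
    {N : Submodule F M} (hg : ∀ v ∈ N, g v ∈ N) (hx : ∀ v ∈ N, x v ∈ N) {L : ℕ}
    (hL : ∀ (l : ℕ) (u : Fin l → M), (∀ j, u j ∈ N) → PolyIndependent f u → l ≤ L) :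
    N ≤ polyTorsion f := by
  let I : Ideal F[X][X] :=
    { carrier := {P | ∀ v ∈ N, evalTwo h P v ∈ polyTorsion f}
      zero_mem' := fun v _ => by simp
      add_mem' := fun {P Q} hP hQ v hv => by
        rw [map_add, LinearMap.add_apply]
        exact add_mem (hP v hv) (hQ v hv)
      smul_mem' := fun P Q hQ v hv => by
        rw [smul_eq_mul, map_mul, Module.End.mul_apply]
        exact apply_mem_polyTorsion (commute_evalTwo h P) (hQ v hv) }
  obtain ⟨P, hP0, hP⟩ := exists_evalTwo_mem_polyTorsion h hg hL
  have hI : I ≠ ⊥ := fun hbot => hP0 (by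
    have : P ∈ I := hP
    rwa [hbot, Ideal.mem_bot] at this)
  obtain ⟨d, c, hc, hmem⟩ := exists_monomial_mem_of_twist_mem hq0 hq hI fun P hP v hv =>
    shift_mem_polyTorsion_of hfx hxinj (by
      rw [← evalTwo_apply_shift h hfx hgx]
      exact hP _ (hx v hv))
  intro v hv
  have h1 := hmem v hv
  rw [evalTwo_monomial] at h1
  obtain ⟨s, hs, h2⟩ := mem_polyTorsion_of_aeval_mem hc h1
  refine ⟨s, hs, ?_⟩
  have hinj : Function.Injective (g ^ d) := by
    rw [Module.End.coe_pow]; exact hginj.iterate d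
  apply hinj
  rw [map_zero, ← h2, ← Module.End.mul_apply, ← Module.End.mul_apply,
    (commute_aeval (h.pow_right d) s).eq]

end Torsion

section Growth

variable {F M : Type*} [Field F] [AddCommGroup M] [Module F M]

theorem card_le_of_polyIndependent {f : Module.End F M} {W : ℕ → Submodule F M}
    (hfin : ∀ m, FiniteDimensional F (W m)) (hmono : Monotone W) {c d : ℕ}
    (hdim : ∀ m, Module.finrank F (W m) ≤ (2 * m + 1) * d)
    (hf : ∀ m, ∀ v ∈ W m, f v ∈ W (m + c)) {l : ℕ} {u : Fin l → M}
    (hu : ∀ j, ∃ m, u j ∈ W m) (hind : PolyIndependent f u) : l ≤ 2 * c * d := by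
  choose e' he' using hu
  set e := ∑ j, e' j with he
  have hue : ∀ j, u j ∈ W e := fun j =>
    hmono (Finset.single_le_sum (f := e') (fun _ _ => Nat.zero_le _) (Finset.mem_univ j)) (he' j)
  have hpow : ∀ i j, (f ^ i) (u j) ∈ W (e + i * c) := by
    intro i j
    induction i with
    | zero => simpa using hue j
    | succ i ih =>
      rw [pow_succ', Module.End.mul_apply]
      have := hf _ _ ih
      rwa [add_assoc, ← Nat.succ_mul] at this
  set m := (2 * e + 1) * d with hm
  have hmem : ∀ p : Fin (m + 1) × Fin l, (f ^ (p.1 : ℕ)) (u p.2) ∈ W (e + m * c) := fun p =>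
    hmono (Nat.add_le_add_left (Nat.mul_le_mul_right _ (Nat.lt_succ_iff.1 p.1.2)) _) (hpow _ _)
  have hli : LinearIndependent F (fun p : Fin (m + 1) × Fin l =>
      (⟨(f ^ (p.1 : ℕ)) (u p.2), hmem p⟩ : W (e + m * c))) := by
    apply LinearIndependent.of_comp (W (e + m * c)).subtype
    rw [Fintype.linearIndependent_iff]
    intro g hg p
    have h1 := hind (fun j => ∑ i : Fin (m + 1), monomial (i : ℕ) (g (i, j))) (by
      rw [← hg, Fintype.sum_prod_type_right]
      refine Finset.sum_congr rfl fun j _ => ?_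
      rw [map_sum, LinearMap.sum_apply]
      refine Finset.sum_congr rfl fun i _ => ?_
      simp [aeval_monomial])
    have h2 := congrArg (fun P => coeff P (p.1 : ℕ)) (congrFun h1 p.2)
    simpa [finsetSum_coeff, coeff_monomial, Fin.val_inj] using h2
  have hcard := hli.fintype_card_le_finrank
  rw [Fintype.card_prod, Fintype.card_fin, Fintype.card_fin] at hcard
  have := hcard.trans (hdim _)
  by_contra! hlt
  have h3 : (m + 1) * (2 * c * d + 1) ≤ (m + 1) * l := Nat.mul_le_mul_left _ hlt
  have h4 : (m + 1) * (2 * c * d + 1) ≤ (2 * (e + m * c) + 1) * d := h3.trans this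
  have h5 : (2 * (e + m * c) + 1) * d = m + 2 * c * d * m := by rw [hm]; ring
  nlinarith

end Growth

section Laurent

variable {F K M : Type*} [Field F] [Field K] [AddCommGroup M] [Module K M] [Module F M]

variable (F) in
/-- The span of `x ^ i • w j` for `|i| ≤ m`. -/
def laurentSpan {d : ℕ} (x : K) (w : Fin d → M) (m : ℕ) : Submodule F M :=
  Submodule.span F (Set.range fun p : Fin (2 * m + 1) × Fin d => x ^ ((p.1 : ℤ) - m) • w p.2)

theorem zpow_smul_mem_laurentSpan {d : ℕ} (x : K) (w : Fin d → M) {m : ℕ} {i : ℤ}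
    (h1 : -(m : ℤ) ≤ i) (h2 : i ≤ m) (j : Fin d) : x ^ i • w j ∈ laurentSpan F x w m :=
  Submodule.subset_span ⟨(⟨(i + m).toNat, by omega⟩, j), by
    have : (((i + m).toNat : ℤ)) = i + m := Int.toNat_of_nonneg (by omega)
    simp [this]⟩

theorem laurentSpan_induction {d : ℕ} {x : K} {w : Fin d → M} {m : ℕ} {S : Submodule F M}
    (h : ∀ i : ℤ, -(m : ℤ) ≤ i → i ≤ m → ∀ j, x ^ i • w j ∈ S) : laurentSpan F x w m ≤ S := by
  refine Submodule.span_le.2 ?_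
  rintro _ ⟨p, rfl⟩
  exact h _ (by omega) (by omega) _

theorem laurentSpan_mono {d : ℕ} (x : K) (w : Fin d → M) : Monotone (laurentSpan F x w) :=
  fun _ _ hmn => laurentSpan_induction fun _ h1 h2 j =>
    zpow_smul_mem_laurentSpan x w (by omega) (by omega) j

theorem finrank_laurentSpan_le {d : ℕ} (x : K) (w : Fin d → M) (m : ℕ) :
    Module.finrank F (laurentSpan F x w m) ≤ (2 * m + 1) * d := by
  refine (finrank_range_le_card _).trans ?_
  simp

variable [Algebra F K] [IsScalarTower F K M]

theorem zpow_smul_mem_laurentSpan_add {d : ℕ} {x : K} (hx : x ≠ 0) {w : Fin d → M} {m c : ℕ}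
    {i : ℤ} (h1 : -(m : ℤ) ≤ i) (h2 : i ≤ m) {v : M} (hv : v ∈ laurentSpan F x w c) :
    x ^ i • v ∈ laurentSpan F x w (m + c) := by
  let T : M →ₗ[F] M := LinearMap.restrictScalars F (LinearMap.lsmul K M (x ^ i))
  suffices laurentSpan F x w c ≤ (laurentSpan F x w (m + c)).comap T from this hv
  refine laurentSpan_induction fun k h3 h4 j => ?_
  rw [Submodule.mem_comap]
  change x ^ i • x ^ k • w j ∈ _
  rw [smul_smul, ← zpow_add₀ hx]
  exact zpow_smul_mem_laurentSpan x w (by push_cast; omega) (by push_cast; omega) j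

theorem nabla_zpow_smul {x : K} (hx : x ≠ 0) {f : Module.End F M}
    (hf : ∀ v, f (x • v) = x • (f v + v)) (i : ℤ) (v : M) :
    f (x ^ i • v) = x ^ i • (f v + (i : F) • v) := by
  have hsm : ∀ (a : F) (k : K) (v : M), a • k • v = k • a • v := fun a k v => smul_comm _ _ _
  induction i generalizing v with
  | zero => simp
  | succ i ih =>
    rw [zpow_add_one₀ hx, mul_smul, ih, hf, hsm, mul_smul]
    congr 1
    rw [← smul_add]
    congr 1
    push_cast
    rw [add_smul, one_smul]
    abel
  | pred i ih =>
    have key : x • f (x ^ (-(i : ℤ) - 1) • v) =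
        x • (x ^ (-(i : ℤ) - 1) • (f v + (((-(i : ℤ) - 1 : ℤ)) : F) • v)) := by
      have h1 := hf (x ^ (-(i : ℤ) - 1) • v)
      have h3 : ∀ u : M, x • x ^ (-(i : ℤ) - 1) • u = x ^ (-(i : ℤ)) • u := fun u => by
        rw [smul_smul, ← zpow_one_add₀ hx]; congr 2; ring
      rw [h3, ih, smul_add x] at h1
      rw [h3] at h1 ⊢
      rw [← sub_eq_iff_eq_add] at h1
      rw [← h1, ← smul_sub]
      congr 1
      push_cast
      rw [sub_smul, one_smul]
      abel
    exact smul_right_injective M hx key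

variable [Algebra F[X] K] [IsScalarTower F F[X] K] [Module F[X] M] [IsScalarTower F[X] K M]

theorem exists_mem_laurentSpan {d : ℕ} {w : Fin d → M}
    (hx : algebraMap F[X] K X ≠ 0) {v : M} (hv : v ∈ Submodule.span F[X] (Set.range w)) :
    ∃ m, v ∈ laurentSpan F (algebraMap F[X] K X) w m := by
  set x := algebraMap F[X] K X with hxdef
  induction hv using Submodule.span_induction with
  | mem v hv =>
    obtain ⟨j, rfl⟩ := hv
    exact ⟨0, by simpa using zpow_smul_mem_laurentSpan (F := F) x w (m := 0) (i := 0) (by simp) (by simp) j⟩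
  | zero => exact ⟨0, zero_mem _⟩
  | add v u _ _ hv hu =>
    obtain ⟨m, hm⟩ := hv
    obtain ⟨n, hn⟩ := hu
    exact ⟨m + n, add_mem (laurentSpan_mono x w (by omega) hm) (laurentSpan_mono x w (by omega) hn)⟩
  | smul p v _ hv =>
    obtain ⟨m, hm⟩ := hv
    induction p using Polynomial.induction_on' with
    | add p r hp hr =>
      obtain ⟨a, ha⟩ := hp
      obtain ⟨b, hb⟩ := hr
      refine ⟨a + b, ?_⟩
      rw [add_smul]
      exact add_mem (laurentSpan_mono x w (by omega) ha) (laurentSpan_mono x w (by omega) hb)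
    | monomial k a =>
      refine ⟨k + m, ?_⟩
      have : (monomial k a : F[X]) • v = a • x ^ (k : ℤ) • v := by
        rw [← algebraMap_smul K (monomial k a), ← algebraMap_smul K a, smul_smul,
          ← C_mul_X_pow_eq_monomial, map_mul, map_pow, IsScalarTower.algebraMap_apply F F[X] K,
          zpow_natCast, ← hxdef]
        rfl
      rw [this]
      exact Submodule.smul_mem _ _ (zpow_smul_mem_laurentSpan_add hx (by omega) (by omega) hm)

theorem exists_bound_polyIndependent (hx : algebraMap F[X] K X ≠ 0) {f : Module.End F M}
    (hf : ∀ v, f (algebraMap F[X] K X • v) = algebraMap F[X] K X • (f v + v))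
    {N : Submodule F M} {d : ℕ} {w : Fin d → M} (hw : ∀ j, f (w j) ∈ N)
    (hN : ∀ v ∈ N, ∃ i : ℕ, algebraMap F[X] K X ^ i • v ∈ Submodule.span F[X] (Set.range w)) :
    ∃ L, ∀ (l : ℕ) (u : Fin l → M), (∀ j, u j ∈ N) → PolyIndependent f u → l ≤ L := by
  set x := algebraMap F[X] K X with hxdef
  have hmem : ∀ v ∈ N, ∃ m, v ∈ laurentSpan F x w m := by
    intro v hv
    obtain ⟨i, hi⟩ := hN v hv
    obtain ⟨m, hm⟩ := exists_mem_laurentSpan hx hi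
    refine ⟨i + m, ?_⟩
    have := zpow_smul_mem_laurentSpan_add hx (m := i) (i := -(i : ℤ)) (by simp) (by omega) hm
    rwa [smul_smul, zpow_neg, zpow_natCast, inv_mul_cancel₀ (pow_ne_zero _ hx), one_smul]
      at this
  choose c' hc' using fun j => hmem _ (hw j)
  set c := ∑ j, c' j with hc
  have hwc : ∀ j, f (w j) ∈ laurentSpan F x w c := fun j =>
    laurentSpan_mono x w
      (Finset.single_le_sum (f := c') (fun _ _ => Nat.zero_le _) (Finset.mem_univ j)) (hc' j)
  refine ⟨2 * c * d, fun l u hu hind => card_le_of_polyIndependent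
    (W := laurentSpan F x w)
    (fun m => FiniteDimensional.span_of_finite F (Set.finite_range _))
    (laurentSpan_mono x w) (finrank_laurentSpan_le x w) (fun m v hv => ?_)
    (fun j => hmem _ (hu j)) hind⟩
  suffices laurentSpan F x w m ≤ (laurentSpan F x w (m + c)).comap f from this hv
  refine laurentSpan_induction fun i h1 h2 j => ?_
  rw [Submodule.mem_comap, nabla_zpow_smul hx hf, smul_add, smul_comm]
  refine add_mem (zpow_smul_mem_laurentSpan_add hx h1 h2 (hwc j)) (Submodule.smul_mem _ _ ?_)
  exact zpow_smul_mem_laurentSpan x w (by push_cast; omega) (by push_cast; omega) j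

end Laurent

section Eigenspaces

variable {F M : Type*} [Field F] [AddCommGroup M] [Module F M]

theorem polyTorsion_le_iSup_maxGenEigenspace [IsAlgClosed F] (f : Module.End F M) :
    polyTorsion f ≤ ⨆ α, f.maxGenEigenspace α := by
  rintro v ⟨s, hs, hv⟩
  induction hn : s.natDegree using Nat.strong_induction_on generalizing s v with
  | _ n ih =>
    by_cases h0 : s.natDegree = 0
    · obtain ⟨a, rfl⟩ := natDegree_eq_zero.1 h0
      rw [aeval_C, Module.algebraMap_end_apply] at hv
      have : v = 0 := (smul_eq_zero.1 hv).resolve_left (by simpa using hs)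
      rw [this]; exact zero_mem _
    · obtain ⟨α, hα⟩ := IsAlgClosed.exists_root s (fun h => h0 (natDegree_eq_of_degree_eq_some h))
      obtain ⟨r, hr, hndvd⟩ := exists_eq_pow_rootMultiplicity_mul_and_not_dvd s hs α
      set k := s.rootMultiplicity α
      have hk : 0 < k := (rootMultiplicity_pos hs).2 hα
      have hcop : IsCoprime ((X - C α) ^ k) r :=
        ((irreducible_X_sub_C α).coprime_iff_not_dvd.2 hndvd).pow_left
      have hmem : v ∈ (aeval f ((X - C α) ^ k)).ker ⊔ (aeval f r).ker := by
        rw [sup_ker_aeval_eq_ker_aeval_mul_of_coprime f hcop, ← hr]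
        exact hv
      obtain ⟨y, hy, z, hz, rfl⟩ := Submodule.mem_sup.1 hmem
      refine add_mem (Submodule.mem_iSup_of_mem α ?_) ?_
      · rw [Module.End.mem_maxGenEigenspace]
        refine ⟨k, ?_⟩
        rw [LinearMap.mem_ker, map_pow, map_sub, aeval_X, aeval_C] at hy
        rwa [← Algebra.algebraMap_eq_smul_one]
      · have hr0 : r ≠ 0 := fun h => hs (by rw [hr, h, mul_zero])
        refine ih r.natDegree ?_ r hr0 hz rfl
        rw [← hn, hr, natDegree_mul (pow_ne_zero _ (X_sub_C_ne_zero α)) hr0, natDegree_pow,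
          natDegree_X_sub_C]
        omega

variable {K : Type*} [Field K] [Module K M] [Algebra F K] [IsScalarTower F K M]

theorem zpow_smul_mem_maxGenEigenspace {x : K} (hx : x ≠ 0) {f : Module.End F M}
    (hf : ∀ v, f (x • v) = x • (f v + v)) (i : ℤ) {α : F} {v : M}
    (hv : v ∈ f.maxGenEigenspace α) : x ^ i • v ∈ f.maxGenEigenspace (α + i) := by
  rw [Module.End.mem_maxGenEigenspace] at hv ⊢
  obtain ⟨k, hk⟩ := hv
  refine ⟨k, ?_⟩
  have key : ∀ (k : ℕ) (u : M), ((f - (α + i) • 1) ^ k) (x ^ i • u) = x ^ i • ((f - α • 1) ^ k) u := by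
    intro k
    induction k with
    | zero => simp
    | succ k ih =>
      intro u
      rw [pow_succ, pow_succ, Module.End.mul_apply, Module.End.mul_apply, ← ih]
      congr 1
      simp only [LinearMap.sub_apply, LinearMap.smul_apply, Module.End.one_apply,
        nabla_zpow_smul hx hf]
      rw [smul_comm (α + (i : F)), ← smul_sub, add_smul]
      congr 1
      abel
  rw [key, hk, smul_zero]

variable (F) in
theorem exists_representatives_mod_int : ∃ rep : F → F,
    (∀ α, ∃ i : ℤ, α = rep α + i) ∧ ∀ (α : F) (i : ℤ), rep (α + i) = rep α := by
  refine ⟨fun α => Quotient.out (α : F ⧸ (Int.castAddHom F).range), fun α => ?_, fun α i => ?_⟩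
  · have h : ((Quotient.out (α : F ⧸ (Int.castAddHom F).range) : F) :
        F ⧸ (Int.castAddHom F).range) = α := Quotient.out_eq' _
    obtain ⟨i, hi⟩ := QuotientAddGroup.eq.1 h
    refine ⟨i, ?_⟩
    change (i : F) = _ at hi
    change α = Quotient.out _ + (i : F)
    rw [hi]
    abel
  · dsimp only
    congr 1
    exact (QuotientAddGroup.eq (s := (Int.castAddHom F).range).2 ⟨i, by simp⟩).symm

variable [Algebra F[X] K] [IsScalarTower F F[X] K] [Module F[X] M] [IsScalarTower F[X] K M]

theorem monomial_smul_eq (k : ℕ) (a : F) (v : M) :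
    (monomial k a : F[X]) • v = algebraMap F[X] K X ^ (k : ℤ) • a • v := by
  rw [← algebraMap_smul K (monomial k a), ← algebraMap_smul K a, smul_smul,
    ← C_mul_X_pow_eq_monomial, map_mul, map_pow, IsScalarTower.algebraMap_apply F F[X] K,
    zpow_natCast, mul_comm]
  rfl

/-- If the torsion vectors of `f` span `M` over `K`, then `M` has a basis on whose span over the
constants `g` acts. -/
theorem exists_basis_of_span_polyTorsion [IsAlgClosed F] [CharZero F] [IsFractionRing F[X] K]
    [FiniteDimensional K M] {f g : Module.End F M} (h : Commute f g)
    (hf : ∀ v, f (algebraMap F[X] K X • v) = algebraMap F[X] K X • (f v + v))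
    (htop : Submodule.span K (polyTorsion f : Set M) = ⊤) :
    ∃ (b : Module.Basis (Fin (Module.finrank K M)) K M)
      (A₀ : Matrix (Fin (Module.finrank K M)) (Fin (Module.finrank K M)) F),
      ∀ i, g (b i) = ∑ j, A₀ i j • b j := by
  classical
  set x := algebraMap F[X] K X with hxdef
  have hx : x ≠ 0 := by
    rw [hxdef, Ne, FaithfulSMul.algebraMap_eq_zero_iff]
    exact X_ne_zero
  obtain ⟨rep, hrep, hrepadd⟩ := exists_representatives_mod_int F
  let E : ℤ → Set F := fun m => {α | α = rep α + m}
  let G : F → Submodule F M := f.maxGenEigenspace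
  let V : Submodule F M := ⨆ α ∈ E 0, G α
  have hshift : ∀ (m : ℤ), ∀ v ∈ V, x ^ m • v ∈ ⨆ α ∈ E m, G α := by
    intro m
    let T : M →ₗ[F] M := LinearMap.restrictScalars F (LinearMap.lsmul K M (x ^ m))
    suffices V ≤ (⨆ α ∈ E m, G α).comap T from fun v hv => this hv
    refine iSup₂_le fun α hα v hv => ?_
    have h1 : α + m ∈ E m := by
      have : α = rep α := by simpa [E] using hα
      change α + (m : F) = rep (α + m) + m
      rw [hrepadd, ← this]
    exact Submodule.mem_iSup_of_mem _ (Submodule.mem_iSup_of_mem h1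
      (zpow_smul_mem_maxGenEigenspace hx hf m hv))
  have hdisj : ∀ m, Disjoint (⨆ α ∈ E m, G α) (⨆ α ∈ ⋃ k ∈ {k | k ≠ m}, E k, G α) := by
    intro m
    refine f.independent_maxGenEigenspace.disjoint_biSup_biSup ?_
    rw [Set.disjoint_left]
    intro α h1 h2
    obtain ⟨k, hk, hα⟩ := Set.mem_iUnion₂.1 h2
    apply hk
    have h3 : rep α + (m : F) = rep α + k := (h1 : α = rep α + m).symm.trans hα
    exact_mod_cast (add_left_cancel h3).symm
  have hgV : ∀ v ∈ V, g v ∈ V := by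
    suffices V ≤ V.comap g from this
    refine iSup₂_le fun α hα v hv => ?_
    exact Submodule.mem_iSup_of_mem _ (Submodule.mem_iSup_of_mem hα
      (Module.End.mapsTo_maxGenEigenspace_of_comm h α hv))
  have hVspan : Submodule.span K (V : Set M) = ⊤ := by
    rw [← htop]
    refine le_antisymm (htop ▸ le_top) (Submodule.span_le.2 ?_)
    intro v hv
    have h1 := polyTorsion_le_iSup_maxGenEigenspace f hv
    suffices (⨆ α, f.maxGenEigenspace α) ≤ (Submodule.span K (V : Set M)).restrictScalars F
      from this h1
    refine iSup_le fun α u hu => ?_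
    obtain ⟨i, hi⟩ := hrep α
    have h2 : x ^ (-i) • u ∈ V := by
      refine Submodule.mem_iSup_of_mem (α + ((-i : ℤ) : F)) (Submodule.mem_iSup_of_mem ?_
        (zpow_smul_mem_maxGenEigenspace hx hf (-i) hu))
      change _ = rep _ + ((0 : ℤ) : F)
      rw [hrepadd]
      push_cast
      linear_combination hi
    have h3 := (Submodule.span K (V : Set M)).smul_mem (x ^ i) (Submodule.subset_span h2)
    rwa [smul_smul, ← zpow_add₀ hx, add_neg_cancel, zpow_zero, one_smul] at h3
  let c := Module.Basis.ofVectorSpace F V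
  have hli : LinearIndependent K fun i => (c i : M) := by
    rw [← LinearIndependent.iff_fractionRing F[X] K, linearIndependent_iff']
    intro s p hp i hi
    set D := s.sup (fun j => (p j).natDegree) + 1 with hD
    have hsum : ∀ i ∈ s, p i = ∑ k ∈ Finset.range D, monomial k ((p i).coeff k) := fun i hi =>
      as_sum_range' _ _ (Nat.lt_succ_iff.2 (Finset.le_sup (f := fun j => (p j).natDegree) hi))
    let u : ℕ → V := fun k => ∑ i ∈ s, (p i).coeff k • c i
    have hu : ∑ k ∈ Finset.range D, x ^ (k : ℤ) • (u k : M) = 0 := by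
      rw [← hp]
      simp only [u, Submodule.coe_sum, Finset.smul_sum, Submodule.coe_smul]
      rw [Finset.sum_comm]
      refine Finset.sum_congr rfl fun i hi => ?_
      conv_rhs => rw [hsum i hi, Finset.sum_smul]
      exact Finset.sum_congr rfl fun k _ => (monomial_smul_eq k _ _).symm
    have hu0 : ∀ k ∈ Finset.range D, u k = 0 := by
      intro k hk
      have h1 := hshift k (u k) (u k).2
      have h2 : x ^ (k : ℤ) • (u k : M) ∈ ⨆ α ∈ ⋃ j ∈ {j : ℤ | j ≠ k}, E j, G α := by
        rw [← Finset.add_sum_erase _ _ hk] at hu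
        rw [eq_neg_of_add_eq_zero_left hu]
        refine neg_mem (sum_mem fun j hj => ?_)
        have hjk : (j : ℤ) ≠ k := by exact_mod_cast (Finset.mem_erase.1 hj).1
        refine (biSup_mono (fun α hα => ?_) : (⨆ α ∈ E j, G α) ≤ _) (hshift j (u j) (u j).2)
        exact Set.mem_iUnion₂.2 ⟨j, hjk, hα⟩
      have h3 := (Submodule.disjoint_def.1 (hdisj k)) _ h1 h2
      exact Subtype.ext ((smul_eq_zero.1 h3).resolve_left (zpow_ne_zero _ hx))
    ext1 k
    by_cases hk : k ∈ Finset.range D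
    · exact linearIndependent_iff'.1 c.linearIndependent s _ (hu0 k hk) i hi
    · rw [hsum i hi, finsetSum_coeff]
      refine Finset.sum_eq_zero fun j hj => ?_
      rw [coeff_monomial, if_neg]
      rintro rfl
      exact hk hj
  have hspan : ⊤ ≤ Submodule.span K (Set.range fun i => (c i : M)) := by
    rw [← hVspan, Submodule.span_le]
    intro v hv
    have h1 : (⟨v, hv⟩ : V) ∈ Submodule.span F (Set.range c) := by rw [c.span_eq]; trivial
    suffices Submodule.span F (Set.range c) ≤ ((Submodule.span K
      (Set.range fun i => (c i : M))).restrictScalars F).comap V.subtype from this h1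
    rw [Submodule.span_le]
    rintro _ ⟨i, rfl⟩
    exact Submodule.subset_span ⟨i, rfl⟩
  let b := Module.Basis.mk hli hspan
  have : Finite (Module.Basis.ofVectorSpaceIndex F V) := Module.Finite.finite_basis b
  let := Fintype.ofFinite (Module.Basis.ofVectorSpaceIndex F V)
  let e : Module.Basis.ofVectorSpaceIndex F V ≃ Fin (Module.finrank K M) :=
    Fintype.equivFinOfCardEq (Module.finrank_eq_card_basis b).symm
  refine ⟨b.reindex e, fun i j => c.repr ⟨g (c (e.symm i)), hgV _ (c (e.symm i)).2⟩ (e.symm j),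
    fun i => ?_⟩
  have h1 := congrArg Subtype.val (c.sum_repr ⟨g (c (e.symm i)), hgV _ (c (e.symm i)).2⟩)
  simp only [Submodule.coe_sum, Submodule.coe_smul] at h1
  rw [Module.Basis.reindex_apply, Module.Basis.mk_apply, ← h1, ← e.symm.sum_comp]
  simp [b]

end Eigenspaces

section Dilation

variable {F : Type*} [Field F]

/-- The substitution `X ↦ q X`. -/
noncomputable def dil (q : F) : F[X] →+* F[X] := compRingHom (C q * X)

@[simp] theorem dil_X (q : F) : dil q X = C q * X := by simp [dil]

@[simp] theorem dil_C (q a : F) : dil q (C a) = C a := by simp [dil]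

theorem dil_dil (q r : F) (p : F[X]) : dil q (dil r p) = dil (q * r) p := by
  simp only [dil, coe_compRingHom_apply, comp_assoc]
  congr 1
  simp
  ring

@[simp] theorem dil_one (p : F[X]) : dil (1 : F) p = p := by simp [dil]

theorem dil_inv_dil {q : F} (hq : q ≠ 0) (p : F[X]) : dil q⁻¹ (dil q p) = p := by
  rw [dil_dil, inv_mul_cancel₀ hq, dil_one]

theorem dil_dil_inv {q : F} (hq : q ≠ 0) (p : F[X]) : dil q (dil q⁻¹ p) = p := by
  rw [dil_dil, mul_inv_cancel₀ hq, dil_one]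

theorem dil_ne_zero {q : F} (hq : q ≠ 0) {p : F[X]} (hp : p ≠ 0) : dil q p ≠ 0 := by
  intro h
  apply hp
  rw [← dil_inv_dil hq p, h, map_zero]

theorem eval_dil (q a : F) (p : F[X]) : (dil q p).eval a = p.eval (q * a) := by
  simp [dil]

theorem exists_isCoprime_dil [IsAlgClosed F] {q : F} (hq0 : q ≠ 0)
    (hq : ∀ m : ℕ, 0 < m → q ^ m ≠ 1) {f : F[X]} (hf0 : f.eval 0 ≠ 0) :
    ∃ m : ℕ, IsCoprime f (dil (q ^ m) f) := by
  classical
  have hf : f ≠ 0 := by rintro rfl; simp at hf0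
  by_contra! hcon
  have hroot : ∀ m : ℕ, ∃ a, f.eval a = 0 ∧ f.eval (q ^ m * a) = 0 := by
    intro m
    by_contra! h
    refine hcon m ((isCoprime_iff_aeval_ne_zero_of_isAlgClosed F F _ _).2 fun a => ?_)
    by_cases ha : f.eval a = 0
    · right
      simpa [eval_dil] using h a ha
    · left
      simpa using ha
  choose a ha1 ha2 using hroot
  let φ : ℕ → {z // z ∈ f.roots.toFinset} × {z // z ∈ f.roots.toFinset} := fun m =>
    (⟨a m, by simpa [hf] using ha1 m⟩, ⟨q ^ m * a m, by simpa [hf] using ha2 m⟩)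
  obtain ⟨m, n, hmn, he⟩ := Finite.exists_ne_map_eq_of_infinite φ
  wlog hlt : m < n generalizing m n
  · exact this n m hmn.symm he.symm (by omega)
  simp only [φ, Prod.mk.injEq, Subtype.mk.injEq] at he
  obtain ⟨h1, h2⟩ := he
  have hne : a n ≠ 0 := by
    intro h
    exact hf0 (h ▸ ha1 n)
  rw [h1] at h2
  refine hq (n - m) (by omega) ?_
  rw [pow_sub₀ _ hq0 hlt.le, ← mul_right_cancel₀ hne h2, mul_inv_cancel₀ (pow_ne_zero _ hq0)]

end Dilation

section Lattice

variable {F M : Type*} [Field F] [AddCommGroup M] [Module F[X] M]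

theorem smul_mem_of_C_mul_smul_mem {N : Submodule F[X] M} {a : F} (ha : a ≠ 0) {p : F[X]} {v : M}
    (h : (C a * p) • v ∈ N) : p • v ∈ N := by
  have := N.smul_mem (C a⁻¹) h
  rwa [smul_smul, ← mul_assoc, ← C_mul, inv_mul_cancel₀ ha, C_1, one_mul] at this

theorem mem_of_X_pow_smul_mem {N : Submodule F[X] M} (hX : ∀ v, (X : F[X]) • v ∈ N → v ∈ N)
    (j : ℕ) {v : M} (h : (X ^ j : F[X]) • v ∈ N) : v ∈ N := by
  induction j with
  | zero => simpa using h
  | succ j ih =>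
    rw [pow_succ', mul_smul] at h
    exact ih (hX _ h)

/-- Submodules stable under a derivation over `X d/dX` and saturated at `X` are determined up to
commensurability. -/
theorem le_of_smul_mem [CharZero F] {D : M → M}
    (hD : ∀ (p : F[X]) v, D (p • v) = (X * derivative p) • v + p • D v)
    {N₁ N₂ : Submodule F[X] M} (h₁ : ∀ v ∈ N₁, D v ∈ N₁) (h₂ : ∀ v ∈ N₂, D v ∈ N₂)
    (hX : ∀ v, (X : F[X]) • v ∈ N₂ → v ∈ N₂) {p : F[X]} (hp : p ≠ 0)
    (h : ∀ v ∈ N₁, p • v ∈ N₂) : N₁ ≤ N₂ := by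
  classical
  have hex : ∃ d : ℕ, ∃ r : F[X], r ≠ 0 ∧ (∀ v ∈ N₁, r • v ∈ N₂) ∧ r.natDegree = d :=
    ⟨_, p, hp, h, rfl⟩
  obtain ⟨r, hr0, hr, hrd⟩ := Nat.find_spec hex
  set d := r.natDegree with hd
  have hder : ∀ v ∈ N₁, (X * derivative r - C (d : F) * r) • v ∈ N₂ := by
    intro v hv
    have h3 := h₂ _ (hr v hv)
    rw [hD] at h3
    have h4 := N₂.sub_mem h3 (hr _ (h₁ v hv))
    rw [add_sub_cancel_right] at h4
    rw [sub_smul, mul_smul (C (d : F))]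
    exact N₂.sub_mem h4 (N₂.smul_mem _ (hr v hv))
  have hcoeff : ∀ k : ℕ, (X * derivative r - C (d : F) * r).coeff k = ((k : F) - d) * r.coeff k := by
    intro k
    rw [coeff_sub, coeff_C_mul]
    cases k with
    | zero => simp
    | succ k =>
      rw [coeff_X_mul, coeff_derivative]
      push_cast
      ring
  have hzero : X * derivative r - C (d : F) * r = 0 := by
    by_contra hne
    have hle : (X * derivative r - C (d : F) * r).natDegree ≤ d := by
      rw [natDegree_le_iff_coeff_eq_zero]
      intro k hk
      rw [hcoeff, coeff_eq_zero_of_natDegree_lt hk, mul_zero]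
    rcases hle.lt_or_eq with hlt | heq
    · exact Nat.find_min hex (hrd ▸ hlt) ⟨_, hne, hder, rfl⟩
    · apply hne
      rw [← leadingCoeff_eq_zero, leadingCoeff, heq, hcoeff, sub_self, zero_mul]
  have hmon : r = C r.leadingCoeff * X ^ d := by
    ext k
    rw [coeff_C_mul_X_pow]
    split_ifs with hk
    · rw [hk]; rfl
    · have h5 := hcoeff k
      rw [hzero, coeff_zero] at h5
      exact (mul_eq_zero.1 h5.symm).resolve_left (sub_ne_zero.2 (by exact_mod_cast hk))
  intro v hv
  have h6 := hr v hv
  rw [hmon] at h6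
  exact mem_of_X_pow_smul_mem hX d
    (smul_mem_of_C_mul_smul_mem (leadingCoeff_ne_zero.2 hr0) h6)

theorem exists_smul_mem_of_fg {Λ U : Submodule F[X] M}
    (hΛ : ∀ v : M, ∃ p : F[X], p ≠ 0 ∧ p • v ∈ Λ) (hU : U.FG) :
    ∃ p : F[X], p ≠ 0 ∧ ∀ v ∈ U, p • v ∈ Λ := by
  obtain ⟨n, w, rfl⟩ := Submodule.fg_iff_exists_fin_generating_family.1 hU
  choose p hp0 hp using fun j => hΛ (w j)
  refine ⟨∏ j, p j, Finset.prod_ne_zero_iff.2 fun j _ => hp0 j, fun v hv => ?_⟩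
  suffices Submodule.span F[X] (Set.range w) ≤ Λ.comap (LinearMap.lsmul F[X] M (∏ j, p j)) from
    this hv
  rw [Submodule.span_le]
  rintro _ ⟨j, rfl⟩
  change (∏ j, p j) • w j ∈ Λ
  rw [← Finset.prod_erase_mul _ _ (Finset.mem_univ j), mul_smul]
  exact Λ.smul_mem _ (hp j)

theorem exists_smul_semilinear_mem {Λ : Submodule F[X] M} (hfg : Λ.FG)
    (hΛ : ∀ v : M, ∃ p : F[X], p ≠ 0 ∧ p • v ∈ Λ) {q : F} {ψ : M →+ M}
    (hψ : ∀ (p : F[X]) v, ψ (p • v) = dil q p • ψ v) :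
    ∃ p : F[X], p ≠ 0 ∧ ∀ v ∈ Λ, p • ψ v ∈ Λ := by
  obtain ⟨n, w, hw⟩ := Submodule.fg_iff_exists_fin_generating_family.1 hfg
  obtain ⟨p, hp0, hp⟩ := exists_smul_mem_of_fg hΛ
    (U := Submodule.span F[X] (Set.range fun j => ψ (w j)))
    (Submodule.fg_span (Set.finite_range _))
  refine ⟨p, hp0, fun v hv => hp _ ?_⟩
  rw [← hw] at hv
  induction hv using Submodule.span_induction with
  | mem v hv => obtain ⟨j, rfl⟩ := hv; exact Submodule.subset_span ⟨j, rfl⟩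
  | zero => rw [map_zero]; exact zero_mem _
  | add v u _ _ hv hu => rw [map_add]; exact add_mem hv hu
  | smul r v _ hv => rw [hψ]; exact Submodule.smul_mem _ _ hv

theorem exists_smul_derivation_mem {Λ : Submodule F[X] M} (hfg : Λ.FG)
    (hΛ : ∀ v : M, ∃ p : F[X], p ≠ 0 ∧ p • v ∈ Λ) {D : M →+ M}
    (hD : ∀ (p : F[X]) v, D (p • v) = (X * derivative p) • v + p • D v) :
    ∃ p : F[X], p ≠ 0 ∧ ∀ v ∈ Λ, p • D v ∈ Λ := by
  obtain ⟨n, w, hw⟩ := Submodule.fg_iff_exists_fin_generating_family.1 hfg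
  obtain ⟨p, hp0, hp⟩ := exists_smul_mem_of_fg hΛ
    (U := Λ ⊔ Submodule.span F[X] (Set.range fun j => D (w j)))
    (hfg.sup (Submodule.fg_span (Set.finite_range _)))
  refine ⟨p, hp0, fun v hv => hp _ ?_⟩
  rw [← hw] at hv
  induction hv using Submodule.span_induction with
  | mem v hv =>
    obtain ⟨j, rfl⟩ := hv
    exact Submodule.mem_sup_right (Submodule.subset_span ⟨j, rfl⟩)
  | zero => rw [map_zero]; exact zero_mem _
  | add v u _ _ hv hu => rw [map_add]; exact add_mem hv hu
  | smul r v hv' hv =>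
    rw [hD]
    exact add_mem (Submodule.mem_sup_left (Λ.smul_mem _ (hw ▸ hv'))) (Submodule.smul_mem _ _ hv)

/-- The vectors moved into `Λ` by a power of `h`. -/
def saturation (h : F[X]) (Λ : Submodule F[X] M) : Submodule F[X] M where
  carrier := {v | ∃ i : ℕ, h ^ i • v ∈ Λ}
  zero_mem' := ⟨0, by simp⟩
  add_mem' := by
    rintro v u ⟨i, hi⟩ ⟨j, hj⟩
    refine ⟨i + j, ?_⟩
    rw [smul_add]
    refine Λ.add_mem ?_ ?_
    · rw [add_comm, pow_add, mul_smul]; exact Λ.smul_mem _ hi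
    · rw [pow_add, mul_smul]; exact Λ.smul_mem _ hj
  smul_mem' := by
    rintro p v ⟨i, hi⟩
    exact ⟨i, by rw [smul_comm]; exact Λ.smul_mem _ hi⟩

theorem le_saturation (h : F[X]) (Λ : Submodule F[X] M) : Λ ≤ saturation h Λ :=
  fun v hv => ⟨0, by simpa using hv⟩

theorem derivation_mem_saturation {h : F[X]} {Λ : Submodule F[X] M} {D : M → M}
    (hD : ∀ (p : F[X]) v, D (p • v) = (X * derivative p) • v + p • D v)
    (hh : ∀ v ∈ Λ, h • D v ∈ Λ) {v : M} (hv : v ∈ saturation h Λ) : D v ∈ saturation h Λ := by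
  obtain ⟨i, hi⟩ := hv
  refine ⟨i + 1, ?_⟩
  have h1 := hh _ hi
  rw [hD, smul_add, smul_smul, smul_smul, ← pow_succ'] at h1
  have h2 : (h * (X * derivative (h ^ i))) • v ∈ Λ := by
    rw [derivative_pow]
    cases i with
    | zero => simp
    | succ i =>
      have : h * (X * (C ((i + 1 : ℕ) : F) * h ^ (i + 1 - 1) * derivative h)) =
          (X * C ((i + 1 : ℕ) : F) * derivative h) * h ^ (i + 1) := by
        rw [Nat.add_sub_cancel]; ring
      rw [this, mul_smul]
      exact Λ.smul_mem _ hi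
  exact (Λ.add_mem_iff_right h2).1 h1

theorem mem_saturation_of_X_smul_mem {h : F[X]} (hX : X ∣ h) {Λ : Submodule F[X] M} {v : M}
    (hv : (X : F[X]) • v ∈ saturation h Λ) : v ∈ saturation h Λ := by
  obtain ⟨r, rfl⟩ := hX
  obtain ⟨i, hi⟩ := hv
  refine ⟨i + 1, ?_⟩
  have := Λ.smul_mem r hi
  rw [smul_smul, smul_smul] at this
  convert this using 2
  ring

end Lattice

section StableLattice

variable {F M : Type*} [Field F] [AddCommGroup M] [Module F[X] M]

theorem exists_iterate {q : F} {Φ : M ≃+ M} (hΦ : ∀ (p : F[X]) v, Φ (p • v) = dil q p • Φ v)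
    {D : M → M} (hc : ∀ v, D (Φ v) = Φ (D v)) (m : ℕ) :
    ∃ ψ : M ≃+ M, (∀ (p : F[X]) v, ψ (p • v) = dil (q ^ m) p • ψ v) ∧
      ∀ v, D (ψ v) = ψ (D v) := by
  induction m with
  | zero => exact ⟨AddEquiv.refl M, by simp, by simp⟩
  | succ m ih =>
    obtain ⟨ψ, h1, h2⟩ := ih
    refine ⟨Φ.trans ψ, fun p v => ?_, fun v => ?_⟩
    · simp [hΦ, h1, dil_dil, pow_succ]
    · simp [hc, h2]

theorem symm_smul {q : F} (hq : q ≠ 0) {ψ : M ≃+ M}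
    (hψ : ∀ (p : F[X]) v, ψ (p • v) = dil q p • ψ v) (p : F[X]) (v : M) :
    ψ.symm (p • v) = dil q⁻¹ p • ψ.symm v := by
  rw [AddEquiv.symm_apply_eq, hψ, dil_dil_inv hq, AddEquiv.apply_symm_apply]

theorem exists_derivation_stable [IsAlgClosed F] {q : F} (hq0 : q ≠ 0)
    (hq : ∀ m : ℕ, 0 < m → q ^ m ≠ 1)
    {Φ : M ≃+ M} (hΦ : ∀ (p : F[X]) v, Φ (p • v) = dil q p • Φ v) {D : M →+ M}
    (hD : ∀ (p : F[X]) v, D (p • v) = (X * derivative p) • v + p • D v)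
    (hc : ∀ v, D (Φ v) = Φ (D v)) {Λ : Submodule F[X] M} (hfg : Λ.FG)
    (hΛ : ∀ v : M, ∃ p : F[X], p ≠ 0 ∧ p • v ∈ Λ) :
    ∃ N : Submodule F[X] M, (∀ v ∈ N, D v ∈ N) ∧ (∀ v, (X : F[X]) • v ∈ N → v ∈ N) ∧
      (∃ d : F[X], d ≠ 0 ∧ ∀ v ∈ Λ, d • v ∈ N) ∧
      ∃ b : F[X], b ≠ 0 ∧ ∀ v ∈ N, ∃ r : ℕ, (X ^ r * b) • v ∈ Λ := by
  obtain ⟨h₀, hh0, hh⟩ := exists_smul_derivation_mem hfg hΛ hD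
  obtain ⟨f, hf, hfX⟩ := exists_eq_pow_rootMultiplicity_mul_and_not_dvd h₀ hh0 0
  set k := rootMultiplicity 0 h₀
  rw [C_0, sub_zero] at hf hfX
  have hf0 : f.eval 0 ≠ 0 := by
    rwa [X_dvd_iff, coeff_zero_eq_eval_zero] at hfX
  obtain ⟨m, hm⟩ := exists_isCoprime_dil hq0 hq hf0
  have ha : q ^ m ≠ 0 := pow_ne_zero _ hq0
  obtain ⟨ψ, hψ, hψD⟩ := exists_iterate hΦ hc m
  generalize q ^ m = a at hm ha hψ
  obtain ⟨c₁, hc10, hc1⟩ := exists_smul_semilinear_mem hfg hΛ (ψ := (ψ : M →+ M)) hψ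
  obtain ⟨c₂, hc20, hc2⟩ := exists_smul_semilinear_mem hfg hΛ (ψ := (ψ.symm : M →+ M))
    (symm_smul ha hψ)
  simp only [AddMonoidHom.coe_coe] at hc1 hc2
  set h := X * h₀ with hh'
  have hhX : h = X ^ (k + 1) * f := by rw [hh', hf]; ring
  have hhD : ∀ v ∈ Λ, h • D v ∈ Λ := fun v hv => by
    rw [hh', mul_smul]; exact Λ.smul_mem _ (hh v hv)
  let ψl : M →ₛₗ[dil a] M := { (ψ : M →+ M) with map_smul' := hψ }
  refine ⟨saturation h Λ ⊓ (saturation h Λ).comap ψl, ?_, ?_, ⟨dil a⁻¹ c₁,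
    dil_ne_zero (inv_ne_zero ha) hc10, ?_⟩, c₂ * dil a⁻¹ c₁,
    mul_ne_zero hc20 (dil_ne_zero (inv_ne_zero ha) hc10), ?_⟩
  · rintro v ⟨hv1, hv2⟩
    refine ⟨derivation_mem_saturation hD hhD hv1, ?_⟩
    change ψ (D v) ∈ saturation h Λ
    rw [← hψD]
    exact derivation_mem_saturation hD hhD hv2
  · rintro v ⟨hv1, hv2⟩
    refine ⟨mem_saturation_of_X_smul_mem ⟨h₀, rfl⟩ hv1, ?_⟩
    change ψ _ ∈ saturation h Λ at hv2
    rw [hψ, dil_X] at hv2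
    exact mem_saturation_of_X_smul_mem ⟨h₀, rfl⟩ (smul_mem_of_C_mul_smul_mem ha hv2)
  · intro v hv
    refine ⟨le_saturation _ _ (Λ.smul_mem _ hv), ?_⟩
    change ψ _ ∈ saturation h Λ
    rw [hψ, dil_dil_inv ha]
    exact le_saturation _ _ (hc1 v hv)
  · rintro v ⟨⟨i, hi⟩, ⟨j, hj⟩⟩
    change h ^ j • ψ v ∈ Λ at hj
    have h1 := hc1 _ hi
    rw [hψ, smul_smul] at h1
    have e1 : c₁ * dil a (h ^ i) =
        C (a ^ ((k + 1) * i)) * (X ^ ((k + 1) * i) * dil a f ^ i * c₁) := by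
      rw [hhX]
      simp only [map_pow, map_mul, dil_X]
      ring
    rw [e1] at h1
    have h2 := smul_mem_of_C_mul_smul_mem (pow_ne_zero _ ha) h1
    obtain ⟨u, w, huw⟩ := (hm.pow_left (m := j)).pow_right (n := i)
    have h3 : (X ^ ((k + 1) * (i + j)) * c₁) • ψ v ∈ Λ := by
      have e2 : X ^ ((k + 1) * (i + j)) * c₁ =
          (u * c₁ * X ^ ((k + 1) * i)) * h ^ j +
          (w * X ^ ((k + 1) * j)) * (X ^ ((k + 1) * i) * dil a f ^ i * c₁) := by
        rw [hhX]
        linear_combination (-X ^ ((k + 1) * (i + j)) * c₁) * huw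
      rw [e2, add_smul, mul_smul, mul_smul (w * _)]
      exact Λ.add_mem (Λ.smul_mem _ hj) (Λ.smul_mem _ h2)
    have h4 := hc2 _ h3
    rw [symm_smul ha hψ, AddEquiv.symm_apply_apply, smul_smul] at h4
    refine ⟨(k + 1) * (i + j), smul_mem_of_C_mul_smul_mem
      (pow_ne_zero ((k + 1) * (i + j)) (inv_ne_zero ha)) ?_⟩
    convert h4 using 2
    simp only [map_pow, map_mul, dil_X]
    ring

theorem exists_stable [IsAlgClosed F] [CharZero F] {q : F} (hq0 : q ≠ 0)
    (hq : ∀ m : ℕ, 0 < m → q ^ m ≠ 1)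
    {Φ : M ≃+ M} (hΦ : ∀ (p : F[X]) v, Φ (p • v) = dil q p • Φ v) {D : M →+ M}
    (hD : ∀ (p : F[X]) v, D (p • v) = (X * derivative p) • v + p • D v)
    (hc : ∀ v, D (Φ v) = Φ (D v)) {Λ : Submodule F[X] M} (hfg : Λ.FG)
    (hΛ : ∀ v : M, ∃ p : F[X], p ≠ 0 ∧ p • v ∈ Λ) :
    ∃ N : Submodule F[X] M, (∀ v ∈ N, D v ∈ N) ∧ (∀ v ∈ N, Φ v ∈ N) ∧
      (∃ d : F[X], d ≠ 0 ∧ ∀ v ∈ Λ, d • v ∈ N) ∧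
      ∃ b : F[X], b ≠ 0 ∧ ∀ v ∈ N, ∃ r : ℕ, (X ^ r * b) • v ∈ Λ := by
  obtain ⟨N, hND, hNX, ⟨d, hd0, hd⟩, b, hb0, hb⟩ :=
    exists_derivation_stable hq0 hq hΦ hD hc hfg hΛ
  obtain ⟨c, hc0, hc'⟩ := exists_smul_semilinear_mem hfg hΛ (ψ := (Φ : M →+ M)) hΦ
  simp only [AddMonoidHom.coe_coe] at hc'
  let Φl : M →ₛₗ[dil q] M := { (Φ : M →+ M) with map_smul' := hΦ }
  refine ⟨N, hND, ?_, ⟨d, hd0, hd⟩, b, hb0, hb⟩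
  · refine le_of_smul_mem hD hND (N₂ := N.comap Φl) ?_ ?_
      (mul_ne_zero (dil_ne_zero (inv_ne_zero hq0) (mul_ne_zero hd0 hc0)) hb0) ?_
    · intro v hv
      change Φ (D v) ∈ N
      rw [← hc]
      exact hND _ hv
    · intro v hv
      change Φ _ ∈ N at hv
      rw [hΦ, dil_X] at hv
      exact hNX _ (smul_mem_of_C_mul_smul_mem hq0 hv)
    · intro v hv
      obtain ⟨r, hr⟩ := hb v hv
      have h1 := hd _ (hc' _ hr)
      rw [hΦ, smul_smul, smul_smul] at h1
      change Φ _ ∈ N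
      rw [hΦ]
      refine mem_of_X_pow_smul_mem hNX r ?_
      rw [smul_smul]
      refine smul_mem_of_C_mul_smul_mem (pow_ne_zero r hq0) ?_
      convert h1 using 2
      simp only [map_pow, map_mul, dil_X, dil_dil_inv hq0]
      ring

end StableLattice

section Core

theorem exists_fg_lattice (F K M : Type*) [Field F] [Field K] [AddCommGroup M] [Module K M]
    [Algebra F[X] K] [Module F[X] M] [IsScalarTower F[X] K M] [IsFractionRing F[X] K]
    [FiniteDimensional K M] :
    ∃ Λ : Submodule F[X] M, Λ.FG ∧ ∀ v : M, ∃ p : F[X], p ≠ 0 ∧ p • v ∈ Λ := by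
  classical
  let c := Module.finBasis K M
  refine ⟨Submodule.span F[X] (Set.range c), Submodule.fg_span (Set.finite_range c), fun v => ?_⟩
  obtain ⟨p, hp⟩ := IsLocalization.exist_integer_multiples_of_finset (nonZeroDivisors F[X])
    (Finset.univ.image fun i => c.repr v i)
  refine ⟨p, nonZeroDivisors.coe_ne_zero p, ?_⟩
  rw [← c.sum_repr v, Finset.smul_sum]
  refine sum_mem fun i _ => ?_
  obtain ⟨r, hr⟩ := hp (c.repr v i) (Finset.mem_image_of_mem _ (Finset.mem_univ i))
  rw [← smul_assoc, ← hr, algebraMap_smul]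
  exact Submodule.smul_mem _ _ (Submodule.subset_span ⟨i, rfl⟩)

variable {F K M : Type*} [Field F] [Field K] [AddCommGroup M] [Module K M] [Module F M]
  [Algebra F K] [IsScalarTower F K M] [Algebra F[X] K] [IsScalarTower F F[X] K] [Module F[X] M]
  [IsScalarTower F[X] K M]

theorem exists_basis_of_commute [IsAlgClosed F] [CharZero F] [IsFractionRing F[X] K]
    [FiniteDimensional K M] {q : F} (hq0 : q ≠ 0) (hq : ∀ m : ℕ, 0 < m → q ^ m ≠ 1)
    {Φ : M ≃ₗ[F] M} (hΦ : ∀ (p : F[X]) v, Φ (p • v) = dil q p • Φ v) {D : Module.End F M}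
    (hD : ∀ (p : F[X]) v, D (p • v) = (X * derivative p) • v + p • D v)
    (hc : ∀ v, D (Φ v) = Φ (D v)) :
    ∃ (b : Module.Basis (Fin (Module.finrank K M)) K M)
      (A₀ : Matrix (Fin (Module.finrank K M)) (Fin (Module.finrank K M)) F),
      ∀ i, Φ (b i) = ∑ j, A₀ i j • b j := by
  have : IsScalarTower F F[X] M := .of_algebraMap_smul fun a v => by
    rw [← algebraMap_smul K (algebraMap F F[X] a) v, ← IsScalarTower.algebraMap_apply,
      algebraMap_smul]
  have hx : algebraMap F[X] K X ≠ 0 := by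
    rw [Ne, FaithfulSMul.algebraMap_eq_zero_iff]
    exact X_ne_zero
  have htf : ∀ {p : F[X]}, p ≠ 0 → Function.Injective fun v : M => p • v := by
    intro p hp v u h
    simp only [← algebraMap_smul K p] at h
    exact smul_right_injective M
      (by rwa [Ne, FaithfulSMul.algebraMap_eq_zero_iff] : algebraMap F[X] K p ≠ 0) h
  have hDX : ∀ v, D (algebraMap F[X] K X • v) = algebraMap F[X] K X • (D v + v) := by
    intro v
    rw [algebraMap_smul, algebraMap_smul, hD, derivative_X, mul_one, smul_add, add_comm]
  obtain ⟨Λ, hfg, hΛ⟩ := exists_fg_lattice F K M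
  obtain ⟨N, hND, hNΦ, ⟨d, hd0, hd⟩, b, hb0, hb⟩ :=
    exists_stable hq0 hq (Φ := Φ.toAddEquiv) hΦ (D := D.toAddMonoidHom) hD hc hfg hΛ
  have hfgN : (N ⊓ Λ.comap (LinearMap.lsmul F[X] M b)).FG := by
    have : IsNoetherian F[X] Λ := isNoetherian_of_fg_of_noetherian Λ hfg
    refine Submodule.fg_of_fg_map_injective (LinearMap.lsmul F[X] M b) (htf hb0) ?_
    refine isNoetherian_submodule.1 this _ ?_
    rintro _ ⟨v, ⟨_, hv⟩, rfl⟩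
    exact hv
  obtain ⟨l, w, hw⟩ := Submodule.fg_iff_exists_fin_generating_family.1 hfgN
  have hwN : ∀ j, w j ∈ N := fun j =>
    ((hw ▸ Submodule.subset_span ⟨j, rfl⟩ : w j ∈ N ⊓ Λ.comap (LinearMap.lsmul F[X] M b))).1
  obtain ⟨L, hL⟩ := exists_bound_polyIndependent hx hDX (N := N.restrictScalars F) (w := w)
    (fun j => hND _ (hwN j)) (fun v hv => by
      obtain ⟨r, hr⟩ := hb v hv
      refine ⟨r, ?_⟩
      rw [← map_pow, algebraMap_smul, hw]
      refine ⟨N.smul_mem _ hv, ?_⟩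
      change b • (X ^ r : F[X]) • v ∈ Λ
      rwa [smul_smul, mul_comm])
  have hcomm : Commute D (Φ : Module.End F M) := LinearMap.ext hc
  have hle : N.restrictScalars F ≤ polyTorsion D :=
    le_polyTorsion hcomm (x := (LinearMap.lsmul F[X] M X).restrictScalars F) hq0 hq
      (fun v => by simpa using hDX v)
      (fun v => by
        change Φ ((X : F[X]) • v) = q • (X : F[X]) • Φ v
        rw [hΦ, dil_X, mul_smul, ← algebraMap_eq, algebraMap_smul])
      (htf X_ne_zero) Φ.injective (N := N.restrictScalars F) hNΦ (fun v hv => N.smul_mem _ hv) hL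
  refine exists_basis_of_span_polyTorsion hcomm hDX (eq_top_iff.2 fun v _ => ?_)
  obtain ⟨p, hp0, hp⟩ := hΛ v
  have h1 := Submodule.subset_span (R := K) (hle (hd _ hp))
  rw [smul_smul, ← algebraMap_smul K] at h1
  refine (Submodule.smul_mem_iff _ ?_).1 h1
  rw [Ne, FaithfulSMul.algebraMap_eq_zero_iff]
  exact mul_ne_zero hd0 hp0

end Core

section Gauge

open Matrix

variable {F K : Type*} [Field F] [Field K] [Algebra F K] [Algebra F[X] K] [IsScalarTower F F[X] K]
  [IsFractionRing F[X] K]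

theorem exists_gauge_constant [IsAlgClosed F] [CharZero F] {q : F} (hq0 : q ≠ 0)
    (hq : ∀ m : ℕ, 0 < m → q ^ m ≠ 1) {σ : K ≃+* K}
    (hσ : ∀ p : F[X], σ (algebraMap F[X] K p) = algebraMap F[X] K (dil q p)) {D : K → K}
    (hDadd : ∀ x y, D (x + y) = D x + D y) (hDmul : ∀ x y, D (x * y) = D x * y + x * D y)
    (hDp : ∀ p : F[X], D (algebraMap F[X] K p) = algebraMap F[X] K (X * derivative p))
    (hc : ∀ x, D (σ x) = σ (D x)) {n : ℕ} (A : (Matrix (Fin n) (Fin n) K)ˣ)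
    {B : Matrix (Fin n) (Fin n) K}
    (hB : B.map σ * (A : Matrix (Fin n) (Fin n) K) = A * B + (A : Matrix (Fin n) (Fin n) K).map D) :
    ∃ (T : (Matrix (Fin n) (Fin n) K)ˣ) (A₀ : Matrix (Fin n) (Fin n) F),
      (T : Matrix (Fin n) (Fin n) K).map σ * (A : Matrix (Fin n) (Fin n) K) =
        A₀.map (algebraMap F K) * T := by
  have hσF : ∀ a : F, σ (algebraMap F K a) = algebraMap F K a := fun a => by
    rw [IsScalarTower.algebraMap_apply F F[X] K, hσ, algebraMap_eq, dil_C]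
  have hDF : ∀ a : F, D (algebraMap F K a) = 0 := fun a => by
    rw [IsScalarTower.algebraMap_apply F F[X] K, hDp, algebraMap_eq, derivative_C, mul_zero,
      map_zero]
  let D' : K →+ K := AddMonoidHom.mk' D hDadd
  have hsum : ∀ (u : Fin n → K) (Z : Matrix (Fin n) (Fin n) K),
      (fun j => D ((u ᵥ* Z) j)) = (fun i => D (u i)) ᵥ* Z + u ᵥ* Z.map D := by
    intro u Z
    ext j
    change D' (∑ i, u i * Z i j) = (∑ i, D (u i) * Z i j) + ∑ i, u i * D (Z i j)
    rw [map_sum, ← Finset.sum_add_distrib]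
    exact Finset.sum_congr rfl fun i _ => hDmul _ _
  have hσv : ∀ (u : Fin n → K) (Z : Matrix (Fin n) (Fin n) K),
      (fun j => σ ((u ᵥ* Z) j)) = (fun i => σ (u i)) ᵥ* Z.map σ := by
    intro u Z
    ext j
    exact RingHom.map_vecMul (σ : K →+* K) Z u j
  let Φ : (Fin n → K) ≃ₗ[F] (Fin n → K) :=
    { toFun := fun u => (fun i => σ (u i)) ᵥ* (A : Matrix (Fin n) (Fin n) K)
      invFun := fun v i => σ.symm ((v ᵥ* ((A⁻¹ : (Matrix (Fin n) (Fin n) K)ˣ) :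
        Matrix (Fin n) (Fin n) K)) i)
      map_add' := fun u v => by
        rw [← add_vecMul]
        congr 1
        ext i
        simp
      map_smul' := fun a u => by
        rw [RingHom.id_apply, ← smul_vecMul]
        congr 1
        ext i
        simp [Algebra.smul_def, hσF]
      left_inv := fun u => by
        ext i
        simp [vecMul_vecMul]
      right_inv := fun v => by
        simp [vecMul_vecMul] }
  let E : Module.End F (Fin n → K) :=
    { toFun := fun u => (fun i => D (u i)) + u ᵥ* B
      map_add' := fun u v => by
        ext i
        simp only [Pi.add_apply, hDadd, add_vecMul]
        ring
      map_smul' := fun a u => by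
        ext i
        simp only [smul_vecMul, Pi.add_apply, Pi.smul_apply, RingHom.id_apply]
        simp only [Algebra.smul_def, hDmul, hDF]
        ring }
  obtain ⟨b, A₀, hb⟩ := exists_basis_of_commute (K := K) hq0 hq (Φ := Φ) (D := E)
    (fun p v => by
      change (fun i => σ ((p • v) i)) ᵥ* _ = _ • (fun i => σ (v i)) ᵥ* _
      rw [← smul_vecMul]
      congr 1
      ext i
      simp [Algebra.smul_def, hσ])
    (fun p v => by
      change (fun i => D ((p • v) i)) + (p • v) ᵥ* B = _ • v + p • ((fun i => D (v i)) + v ᵥ* B)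
      rw [smul_vecMul, smul_add, ← add_assoc]
      congr 1
      ext i
      simp only [Pi.add_apply, Pi.smul_apply]
      simp only [Algebra.smul_def, hDmul, hDp])
    (fun v => by
      change (fun j => D (((fun i => σ (v i)) ᵥ* (A : Matrix (Fin n) (Fin n) K)) j)) +
        ((fun i => σ (v i)) ᵥ* (A : Matrix (Fin n) (Fin n) K)) ᵥ* B =
        (fun j => σ (D (v j) + (v ᵥ* B) j)) ᵥ* (A : Matrix (Fin n) (Fin n) K)
      have h1 : (fun j => σ (D (v j) + (v ᵥ* B) j)) =
          (fun j => D (σ (v j))) + (fun i => σ (v i)) ᵥ* B.map σ := by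
        rw [← hσv]
        ext j
        simp [hc]
      rw [hsum, h1, add_vecMul, vecMul_vecMul, vecMul_vecMul, hB, vecMul_add, add_assoc,
        add_comm (_ ᵥ* Matrix.map _ D)])
  have hn : Module.finrank K (Fin n → K) = n := Module.finrank_fin_fun K
  generalize Module.finrank K (Fin n → K) = m at hn b A₀ hb
  subst hn
  have hT : IsUnit (Matrix.of fun i j => b i j) :=
    linearIndependent_rows_iff_isUnit.1 b.linearIndependent
  refine ⟨hT.unit, A₀, ?_⟩
  ext i j
  have h1 := congrFun (hb i) j
  rw [Finset.sum_apply] at h1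
  simp only [Pi.smul_apply, Algebra.smul_def] at h1
  exact h1

end Gauge

section Specialization

theorem exists_algHom_of_finiteType (F R : Type*) [Field F] [IsAlgClosed F] [CommRing R]
    [Nontrivial R] [Algebra F R] [Algebra.FiniteType F R] : Nonempty (R →ₐ[F] F) := by
  obtain ⟨m, hm⟩ := Ideal.exists_maximal R
  let := Ideal.Quotient.field m
  have : Module.Finite F (R ⧸ m) := finite_of_finite_type_of_isJacobsonRing F (R ⧸ m)
  exact ⟨(IsAlgClosed.lift : (R ⧸ m) →ₐ[F] F).comp (Ideal.Quotient.mkₐ F m)⟩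

variable {F L : Type*} [Field F] [Field L] [Algebra F L]

/-- A polynomial system over `F` with a solution over an extension has a solution over `F`. -/
theorem exists_specialization [IsAlgClosed F] {q : F} {n : ℕ} {P Q : Matrix (Fin n) (Fin n) F[X]}
    {S : Matrix (Fin n) (Fin n) L[X]} {g : L[X]} (hg : g ≠ 0)
    (h : ∀ i j, g * ∑ k, dil (algebraMap F L q) (S i k) * (P k j).map (algebraMap F L) =
      dil (algebraMap F L q) g * ∑ k, (P i k).map (algebraMap F L) * S k j +
        g * dil (algebraMap F L q) g * (Q i j).map (algebraMap F L)) :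
    ∃ (S₀ : Matrix (Fin n) (Fin n) F[X]) (g₀ : F[X]), g₀ ≠ 0 ∧
      ∀ i j, g₀ * ∑ k, dil q (S₀ i k) * P k j =
        dil q g₀ * ∑ k, P i k * S₀ k j + g₀ * dil q g₀ * Q i j := by
  classical
  let s : Set L := (⋃ i, ⋃ j, ((S i j).coeffs : Set L)) ∪ g.coeffs ∪ {g.leadingCoeff⁻¹}
  have hs : s.Finite := ((Set.finite_iUnion fun i => Set.finite_iUnion fun j =>
    Finset.finite_toSet _).union (Finset.finite_toSet _)).union (Set.finite_singleton _)
  let R := Algebra.adjoin F s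
  have hsR : s ⊆ R := Algebra.subset_adjoin
  have hfg : R.FG := Subalgebra.fg_def.2 ⟨s, hs, rfl⟩
  have : Algebra.FiniteType F R := Subalgebra.fg_iff_finiteType _ |>.1 hfg
  obtain ⟨φ⟩ := exists_algHom_of_finiteType F R
  have hlift : ∀ p : L[X], (p.coeffs : Set L) ⊆ s → ∃ r : R[X], r.map (algebraMap R L) = p := by
    intro p hp
    rw [← mem_lifts, lifts_iff_coeff_lifts]
    intro k
    by_cases hk : p.coeff k = 0
    · exact ⟨0, by rw [hk, map_zero]⟩
    · exact ⟨⟨p.coeff k, hsR (hp (coeff_mem_coeffs hk))⟩, rfl⟩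
  choose S' hS' using fun i j => hlift (S i j) fun x hx =>
    Or.inl (Or.inl (Set.mem_iUnion₂.2 ⟨i, j, hx⟩))
  obtain ⟨g', hg'⟩ := hlift g fun x hx => Or.inl (Or.inr hx)
  refine ⟨fun i j => (S' i j).map (φ : R →+* F), g'.map (φ : R →+* F), ?_, fun i j => ?_⟩
  · let t : R := ⟨g.leadingCoeff⁻¹, hsR (Or.inr rfl)⟩
    have ht : g'.coeff g.natDegree * t = 1 := by
      apply Subtype.ext
      change algebraMap R L (g'.coeff g.natDegree) * g.leadingCoeff⁻¹ = 1
      rw [← coeff_map, hg']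
      exact mul_inv_cancel₀ (leadingCoeff_ne_zero.2 hg)
    intro h0
    have h1 := congrArg (fun p => coeff p g.natDegree) h0
    simp only [coeff_map, coeff_zero] at h1
    have h2 := congrArg φ ht
    rw [map_mul, map_one] at h2
    change φ (g'.coeff g.natDegree) = 0 at h1
    rw [h1, zero_mul] at h2
    exact zero_ne_one h2
  · have key : g' * ∑ k, (S' i k).comp (C (algebraMap F R q) * X) * (P k j).map (algebraMap F R) =
        g'.comp (C (algebraMap F R q) * X) * ∑ k, (P i k).map (algebraMap F R) * S' k j +
        g' * g'.comp (C (algebraMap F R q) * X) * (Q i j).map (algebraMap F R) := by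
      apply map_injective (algebraMap R L) Subtype.val_injective
      simpa [dil, Polynomial.map_sum, Polynomial.map_map, Polynomial.map_comp, hS', hg',
        ← IsScalarTower.algebraMap_eq, ← IsScalarTower.algebraMap_apply] using h i j
    have hφ : (φ : R →+* F).comp (algebraMap F R) = RingHom.id F := by
      ext a
      exact φ.commutes a
    have hφ' : ∀ p : F[X], (p.map (algebraMap F R)).map (φ : R →+* F) = p := fun p => by
      rw [Polynomial.map_map, hφ, map_id]
    have h3 := congrArg (Polynomial.map (φ : R →+* F)) key
    simpa only [Polynomial.map_mul, Polynomial.map_add, Polynomial.map_sum, Polynomial.map_comp,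
      hφ', map_C, map_X, RingHom.coe_coe, AlgHom.commutes, Algebra.algebraMap_self,
      RingHom.id_apply, dil, coe_compRingHom_apply] using h3

theorem clear_denominators {F K : Type*} [Field F] [Field K] [Algebra F[X] K]
    [IsFractionRing F[X] K] {q : F} (hq : q ≠ 0) {σ : K →+* K}
    (hσ : ∀ p : F[X], σ (algebraMap F[X] K p) = algebraMap F[X] K (dil q p))
    {n : ℕ} {A D B : Matrix (Fin n) (Fin n) K} {P Q S : Matrix (Fin n) (Fin n) F[X]}
    {a g : F[X]} (ha : a ≠ 0) (hg : g ≠ 0)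
    (hA : ∀ i j, algebraMap F[X] K a * A i j = algebraMap F[X] K (P i j))
    (hD : ∀ i j, algebraMap F[X] K a * D i j = algebraMap F[X] K (Q i j))
    (hB : ∀ i j, algebraMap F[X] K g * B i j = algebraMap F[X] K (S i j)) :
    B.map σ * A = A * B + D ↔ ∀ i j, g * ∑ k, dil q (S i k) * P k j =
        dil q g * ∑ k, P i k * S k j + g * dil q g * Q i j := by
  have hne : ∀ {p : F[X]}, p ≠ 0 → algebraMap F[X] K p ≠ 0 := fun hp => by
    rwa [Ne, FaithfulSMul.algebraMap_eq_zero_iff]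
  have hσB : ∀ i j, algebraMap F[X] K (dil q g) * σ (B i j) = algebraMap F[X] K (dil q (S i j)) :=
    fun i j => by rw [← hσ, ← hσ, ← hB, map_mul]
  rw [← Matrix.ext_iff]
  refine forall₂_congr fun i j => ?_
  rw [← (FaithfulSMul.algebraMap_injective F[X] K).eq_iff,
    ← mul_right_inj' (hne (mul_ne_zero (mul_ne_zero ha hg) (dil_ne_zero hq hg)))]
  simp only [Matrix.mul_apply, Matrix.add_apply, Matrix.map_apply, map_mul, map_add, map_sum,
    ← hσB, ← hA, ← hD, ← hB, mul_add, Finset.mul_sum]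
  refine Eq.congr (Finset.sum_congr rfl fun k _ => by ring) (congrArg₂ _
    (Finset.sum_congr rfl fun k _ => by ring) (by ring))

end Specialization

section Descent

theorem exists_ringEquiv_dil {F : Type*} (K : Type*) [Field F] [Field K] [Algebra F[X] K]
    [IsFractionRing F[X] K] {q : F} (hq : q ≠ 0) :
    ∃ σ : K ≃+* K, ∀ p : F[X], σ (algebraMap F[X] K p) = algebraMap F[X] K (dil q p) := by
  let e : F[X] ≃+* F[X] :=
    { dil q with
      invFun := dil q⁻¹
      left_inv := dil_inv_dil hq
      right_inv := dil_dil_inv hq }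
  exact ⟨IsFractionRing.ringEquivOfRingEquiv e,
    fun p => IsFractionRing.ringEquivOfRingEquiv_algebraMap e p⟩

variable {F L K₀ K : Type*} [Field F] [Field L] [Algebra F L] [Field K₀] [Field K]
  [Algebra F[X] K₀] [IsFractionRing F[X] K₀] [Algebra L[X] K]

theorem apply_algebraMap_map {Δ : K → K} (hadd : ∀ x y, Δ (x + y) = Δ x + Δ y)
    (hmul : ∀ x y, Δ (x * y) = Δ x * y + x * Δ y)
    (hC : ∀ a : F, Δ (algebraMap L[X] K (C (algebraMap F L a))) = 0)
    (hX : Δ (algebraMap L[X] K X) = algebraMap L[X] K X) (p : F[X]) :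
    Δ (algebraMap L[X] K (p.map (algebraMap F L))) =
      algebraMap L[X] K ((X * derivative p).map (algebraMap F L)) := by
  induction p using Polynomial.induction_on with
  | C a => simp [hC]
  | add p r hp hr => simp only [Polynomial.map_add, map_add, hadd, hp, hr, mul_add]
  | monomial k a h =>
    rw [pow_succ, ← mul_assoc, Polynomial.map_mul, map_mul, hmul, h, map_X, hX,
      derivative_mul (g := X), derivative_X]
    simp only [Polynomial.map_mul, Polynomial.map_add, map_mul, map_add, map_X, Polynomial.map_one,
      map_one]
    ring

theorem exists_derivation_descent {Δ : K → K} (hadd : ∀ x y, Δ (x + y) = Δ x + Δ y)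
    (hmul : ∀ x y, Δ (x * y) = Δ x * y + x * Δ y)
    (hC : ∀ a : F, Δ (algebraMap L[X] K (C (algebraMap F L a))) = 0)
    (hX : Δ (algebraMap L[X] K X) = algebraMap L[X] K X) {ι : K₀ →+* K}
    (hι : ∀ p : F[X], ι (algebraMap F[X] K₀ p) = algebraMap L[X] K (p.map (algebraMap F L))) :
    ∃ D : K₀ → K₀, (∀ x, ι (D x) = Δ (ι x)) ∧ (∀ x y, D (x + y) = D x + D y) ∧
      (∀ x y, D (x * y) = D x * y + x * D y) ∧
      ∀ p : F[X], D (algebraMap F[X] K₀ p) = algebraMap F[X] K₀ (X * derivative p) := by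
  have hp : ∀ p : F[X],
      Δ (ι (algebraMap F[X] K₀ p)) = ι (algebraMap F[X] K₀ (X * derivative p)) := fun p => by
    rw [hι, hι, apply_algebraMap_map hadd hmul hC hX]
  have hex : ∀ x, ∃ y, ι y = Δ (ι x) := by
    intro x
    obtain ⟨p, r, hr, rfl⟩ := IsFractionRing.div_surjective (A := F[X]) x
    have hr0 : algebraMap F[X] K₀ r ≠ 0 := by
      rw [Ne, FaithfulSMul.algebraMap_eq_zero_iff]
      exact nonZeroDivisors.ne_zero hr
    set x := algebraMap F[X] K₀ p / algebraMap F[X] K₀ r with hx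
    refine ⟨(algebraMap F[X] K₀ (X * derivative p) - algebraMap F[X] K₀ (X * derivative r) * x) /
      algebraMap F[X] K₀ r, ?_⟩
    have h1 : algebraMap F[X] K₀ r * x = algebraMap F[X] K₀ p := mul_div_cancel₀ _ hr0
    have h2 := hp p
    rw [← h1, map_mul, hmul, hp] at h2
    rw [map_div₀, map_sub, ← h2, map_mul ι _ x, add_sub_cancel_left,
      mul_div_cancel_left₀ _ ((map_ne_zero ι).2 hr0)]
  choose D hD using hex
  refine ⟨D, hD, fun x y => ι.injective ?_, fun x y => ι.injective ?_, fun p => ι.injective ?_⟩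
  · rw [map_add, hD, hD, hD, map_add, hadd]
  · rw [map_add, map_mul, map_mul, hD, hD, hD, map_mul, hmul]
  · rw [hD, hp]

theorem exists_common_denominator {n : ℕ} (A B : Matrix (Fin n) (Fin n) K₀) :
    ∃ (P Q : Matrix (Fin n) (Fin n) F[X]) (a : F[X]), a ≠ 0 ∧
      (∀ i j, algebraMap F[X] K₀ a * A i j = algebraMap F[X] K₀ (P i j)) ∧
      ∀ i j, algebraMap F[X] K₀ a * B i j = algebraMap F[X] K₀ (Q i j) := by
  obtain ⟨a, ha⟩ := IsLocalization.exist_integer_multiples_of_finite (nonZeroDivisors F[X])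
    (Sum.elim (fun z : Fin n × Fin n => A z.1 z.2) fun z : Fin n × Fin n => B z.1 z.2)
  choose P hP using fun i j => ha (Sum.inl (i, j))
  choose Q hQ using fun i j => ha (Sum.inr (i, j))
  refine ⟨P, Q, a, nonZeroDivisors.coe_ne_zero a, fun i j => ?_, fun i j => ?_⟩
  · rw [hP, Algebra.smul_def]; rfl
  · rw [hQ, Algebra.smul_def]; rfl

end Descent

end QDilation

/-- q-dilation case of the integrability reduction (after Schäfke–Singer).  Let `C₀` be
algebraically closed of characteristic zero, `q ∈ C₀ˣ` not a root of unity, `C ⊇ C₀` a field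
with a derivation `δ` whose constants are exactly `C₀`, extended to `k = C(x)` by `δ(x) = x`,
and let `σ` be the q-dilation `x ↦ qx`.  If `σ(Y) = AY` with `A ∈ GL_n(C₀(x))` is integrable, i.e. there is `B` over `k`
with `σ(B) = ABA⁻¹ + δ(A)A⁻¹`, then the system is gauge-equivalent over `k` to a system with
constant coefficient matrix in `GL_n(C₀)`. -/
theorem qdilation_integrable_reduction {C0 C : Type*}
    [Field C0] [IsAlgClosed C0] [CharZero C0] [Field C] [Algebra C0 C]
    (q : C0ˣ) (hq : ∀ m : ℕ, 0 < m → q ^ m ≠ 1)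
    (δ : C → C)
    (hδadd : ∀ x y, δ (x + y) = δ x + δ y)
    (hδmul : ∀ x y, δ (x * y) = δ x * y + x * δ y)
    (hδconst : ∀ c : C, δ c = 0 ↔ ∃ c0 : C0, algebraMap C0 C c0 = c)
    (σ : RatFunc C →ₐ[C] RatFunc C) (hσ : σ RatFunc.X = algebraMap C (RatFunc C) (algebraMap C0 C (q : C0)) * RatFunc.X)
    (Δ : RatFunc C → RatFunc C)
    (hΔadd : ∀ x y, Δ (x + y) = Δ x + Δ y)
    (hΔmul : ∀ x y, Δ (x * y) = Δ x * y + x * Δ y)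
    (hΔC : ∀ c : C, Δ (algebraMap C (RatFunc C) c) = algebraMap C (RatFunc C) (δ c))
    (hΔX : Δ RatFunc.X = RatFunc.X)
    (hσΔ : ∀ f, σ (Δ f) = Δ (σ f))
    (n : ℕ) (A : (Matrix (Fin n) (Fin n) (RatFunc C))ˣ)
    -- each entry of `A` lies in `C₀(x)`: it is a ratio of polynomials with `C₀`-coefficients
    (hA : ∀ i j, ∃ p q : Polynomial C0, q ≠ 0 ∧
      (A : Matrix (Fin n) (Fin n) (RatFunc C)) i j *
          algebraMap (Polynomial C) (RatFunc C) (q.map (algebraMap C0 C)) =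
        algebraMap (Polynomial C) (RatFunc C) (p.map (algebraMap C0 C)))
    (B : Matrix (Fin n) (Fin n) (RatFunc C))
    (hB : B.map ⇑σ =
      (A : Matrix (Fin n) (Fin n) (RatFunc C)) * B *
          ((A⁻¹ : (Matrix (Fin n) (Fin n) (RatFunc C))ˣ) : Matrix (Fin n) (Fin n) (RatFunc C)) +
        ((A : Matrix (Fin n) (Fin n) (RatFunc C)).map Δ) *
          ((A⁻¹ : (Matrix (Fin n) (Fin n) (RatFunc C))ˣ) : Matrix (Fin n) (Fin n) (RatFunc C))) :
    ∃ T : (Matrix (Fin n) (Fin n) (RatFunc C))ˣ, ∃ A0 : Matrix (Fin n) (Fin n) C0,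
      ((T : Matrix (Fin n) (Fin n) (RatFunc C)).map ⇑σ) *
          (A : Matrix (Fin n) (Fin n) (RatFunc C)) *
          ((T⁻¹ : (Matrix (Fin n) (Fin n) (RatFunc C))ˣ) : Matrix (Fin n) (Fin n) (RatFunc C)) =
        A0.map (fun c => algebraMap C (RatFunc C) (algebraMap C0 C c)) := by
  have hq0 : (q : C0) ≠ 0 := q.ne_zero
  have hq' : ∀ m : ℕ, 0 < m → (q : C0) ^ m ≠ 1 := fun m hm h =>
    hq m hm (Units.ext (by simpa using h))
  set q₁ := algebraMap C0 C (q : C0) with hq1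
  have hq10 : q₁ ≠ 0 := (map_ne_zero _).2 hq0
  have hinj : Function.Injective ((algebraMap (Polynomial C) (RatFunc C)).comp
      (Polynomial.mapRingHom (algebraMap C0 C))) :=
    (FaithfulSMul.algebraMap_injective (Polynomial C) (RatFunc C)).comp
      (Polynomial.map_injective _ (algebraMap C0 C).injective)
  let ι : RatFunc C0 →+* RatFunc C := IsFractionRing.lift hinj
  have hι : ∀ p : (Polynomial C0), ι (algebraMap (Polynomial C0) (RatFunc C0) p) =
      algebraMap (Polynomial C) (RatFunc C) (p.map (algebraMap C0 C)) :=
    fun p => IsFractionRing.lift_algebraMap hinj p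
  have hCC : ∀ c : C, algebraMap C (RatFunc C) c =
      algebraMap (Polynomial C) (RatFunc C) (Polynomial.C c) :=
    fun c => IsScalarTower.algebraMap_apply C (Polynomial C) (RatFunc C) c
  have hσp : ∀ p : (Polynomial C), σ (algebraMap (Polynomial C) (RatFunc C) p) =
      algebraMap (Polynomial C) (RatFunc C) (QDilation.dil q₁ p) := by
    intro p
    induction p using Polynomial.induction_on with
    | C a => rw [QDilation.dil_C, ← hCC, AlgHom.commutes]
    | add p r hp hr => simp only [map_add, hp, hr]
    | monomial k a h =>
      simp only [map_mul, map_pow, RatFunc.algebraMap_X, hσ, QDilation.dil_C,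
        QDilation.dil_X, ← hCC, AlgHom.commutes]
  obtain ⟨σ₀, hσ0⟩ := QDilation.exists_ringEquiv_dil (RatFunc C0) hq0
  have hισ : ∀ x, ι (σ₀ x) = σ (ι x) := by
    intro x
    refine RingHom.congr_fun (f := ι.comp (σ₀ : RatFunc C0 →+* RatFunc C0))
      (g := (σ : RatFunc C →+* RatFunc C).comp ι)
      (IsLocalization.ringHom_ext (nonZeroDivisors (Polynomial C0)) (RingHom.ext fun p => ?_)) x
    change ι (σ₀ _) = σ (ι _)
    rw [hσ0, hι, hι, hσp]
    simp [QDilation.dil, Polynomial.map_comp, hq1]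
  obtain ⟨D, hιD, hDadd, hDmul, hDp⟩ := QDilation.exists_derivation_descent
    (K₀ := RatFunc C0) hΔadd hΔmul
    (fun a => by rw [← hCC, hΔC, (hδconst _).2 ⟨a, rfl⟩, map_zero])
    (by rw [RatFunc.algebraMap_X, hΔX]) hι
  have hDσ : ∀ x, D (σ₀ x) = σ₀ (D x) := fun x => ι.injective (by
    rw [hιD, hισ, hισ, hιD, hσΔ])
  choose p r hr0 hpr using hA
  let A₁ : Matrix (Fin n) (Fin n) (RatFunc C0) := fun i j =>
    algebraMap (Polynomial C0) (RatFunc C0) (p i j) /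
      algebraMap (Polynomial C0) (RatFunc C0) (r i j)
  have hA1 : A₁.map ι = A := by
    ext i j
    change ι (_ / _) = _
    rw [map_div₀, hι, hι, ← hpr, mul_div_cancel_right₀]
    rw [Ne, FaithfulSMul.algebraMap_eq_zero_iff,
      Polynomial.map_eq_zero_iff (algebraMap C0 C).injective]
    exact hr0 i j
  have hA1u : IsUnit A₁ := by
    rw [Matrix.isUnit_iff_isUnit_det, isUnit_iff_ne_zero, ← map_ne_zero ι, RingHom.map_det,
      ← isUnit_iff_ne_zero, ← Matrix.isUnit_iff_isUnit_det]
    exact (congrArg IsUnit hA1).mpr A.isUnit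
  have hBA : B.map σ * (A : Matrix (Fin n) (Fin n) (RatFunc C)) =
      (A : Matrix (Fin n) (Fin n) (RatFunc C)) * B +
        (A : Matrix (Fin n) (Fin n) (RatFunc C)).map Δ := by
    rw [hB, add_mul, Units.inv_mul_cancel_right, Units.inv_mul_cancel_right]
  obtain ⟨P, Q, a, ha, hP, hQ⟩ := QDilation.exists_common_denominator (F := C0) A₁ (A₁.map D)
  obtain ⟨S, -, g, hg, hS, -⟩ := QDilation.exists_common_denominator (F := C) B B
  have hpoly := (QDilation.clear_denominators hq10 (σ := (σ : RatFunc C →+* RatFunc C)) hσp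
    (D := (A : Matrix (Fin n) (Fin n) (RatFunc C)).map Δ)
    (P := P.map (Polynomial.map (algebraMap C0 C))) (Q := Q.map (Polynomial.map (algebraMap C0 C)))
    ((Polynomial.map_ne_zero_iff (algebraMap C0 C).injective).2 ha) hg
    (fun i j => by
      rw [← hA1, ← hι, Matrix.map_apply, ← map_mul, hP, hι]
      rfl)
    (fun i j => by
      rw [← hA1, ← hι, Matrix.map_apply, Matrix.map_apply, ← hιD, ← map_mul]
      exact (congrArg ι (hQ i j)).trans (hι _))
    hS).1 hBA
  obtain ⟨S₀, g₀, hg0, hpoly0⟩ := QDilation.exists_specialization hg hpoly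
  have hB0 := (QDilation.clear_denominators hq0 (σ := (σ₀ : RatFunc C0 →+* RatFunc C0)) hσ0
    (B := fun i j => algebraMap (Polynomial C0) (RatFunc C0) (S₀ i j) /
      algebraMap (Polynomial C0) (RatFunc C0) g₀)
    ha hg0 hP hQ (fun i j => mul_div_cancel₀ _ (by
      rwa [Ne, FaithfulSMul.algebraMap_eq_zero_iff]))).2 hpoly0
  obtain ⟨T, A₀, hT⟩ :=
    QDilation.exists_gauge_constant hq0 hq' hσ0 hDadd hDmul hDp hDσ hA1u.unit hB0
  refine ⟨Units.map (RingHom.mapMatrix ι).toMonoidHom T, A₀, ?_⟩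
  rw [Units.mul_inv_eq_iff_eq_mul]
  have h1 := congrArg (fun Z => Matrix.map Z ι) hT
  simp only [Matrix.map_mul, IsUnit.unit_spec, hA1, Matrix.map_map] at h1
  refine (congrArg (· * (A : Matrix (Fin n) (Fin n) (RatFunc C))) ?_).trans
    (h1.trans (congrArg (· * (T : Matrix (Fin n) (Fin n) (RatFunc C0)).map ι) ?_))
  · ext i j
    exact (hισ _).symm
  · ext i j
    change ι _ = _
    rw [IsScalarTower.algebraMap_apply C0 (Polynomial C0) (RatFunc C0), Polynomial.algebraMap_eq, hι,
      Polynomial.map_C, ← hCC]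
    rfl
end
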